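/- Let V be a pseudovariety of semigroups such that: some finite semigroup satisfying x·x = x and x·y·x = x·y for all x, y does not belong to V; some finite semigroup satisfying x·x = x and x·y·x = y·x for all x, y does not belong to V; and some finite semigroup possessing a zero element z (i.e. z·s = s·z = z for all s) and satisfying x·x = z and x·y·x = z for all x, y does not belong to V. Then there exists a constant c > 0 such that for every S ∈ V, every subset Σ ⊆ S, and every t in the subsemigroup generated by Σ, the straight-line cost satisfies c_S(t; Σ) ≤ c·(log₂|S| + 1)². -/

import Mathlib

/-- A straight-line sequence over `Sig` in a semigroup: every entry is either a
generator from `Sig` or a product of two earlier entries. -/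
def IsSLSeq {S : Type*} [Semigroup S] (Sig : Set S) (L : List S) : Prop :=
  ∀ m : Fin L.length, L.get m ∈ Sig ∨
    ∃ i j : Fin L.length, (i : ℕ) < (m : ℕ) ∧ (j : ℕ) < (m : ℕ) ∧ L.get m = L.get i * L.get j

/-- The straight-line cost of `t` over `Sig`: the minimal length of a straight-line
sequence over `Sig` containing `t`. -/
noncomputable def slCost {S : Type*} [Semigroup S] (Sig : Set S) (t : S) : ℕ :=
  sInf { n : ℕ | ∃ L : List S, IsSLSeq Sig L ∧ t ∈ L ∧ L.length = n }

/-- A pseudovariety of (finite) semigroups: a class of finite semigroups closed under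
isomorphism and subsemigroups (via injective homomorphisms), homomorphic images
(via surjective homomorphisms), and finite direct products. -/
structure Pseudovariety : Type 1 where
  mem : ∀ (S : Type) [Semigroup S] [Fintype S], Prop
  closed_sub : ∀ (S T : Type) [Semigroup S] [Fintype S] [Semigroup T] [Fintype T]
    (f : S →ₙ* T), Function.Injective f → mem T → mem S
  closed_hom : ∀ (S T : Type) [Semigroup S] [Fintype S] [Semigroup T] [Fintype T]
    (f : S →ₙ* T), Function.Surjective f → mem S → mem T
  closed_prod : ∀ (S T : Type) [Semigroup S] [Fintype S] [Semigroup T] [Fintype T],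
    mem S → mem T → mem (S × T)

/-- A left-regular band: `x·x = x` and `x·y·x = x·y`. -/
def IsLRB (S : Type*) [Semigroup S] : Prop :=
  (∀ x : S, x * x = x) ∧ ∀ x y : S, x * y * x = x * y

/-- A right-regular band: `x·x = x` and `x·y·x = y·x`. -/
def IsRRB (S : Type*) [Semigroup S] : Prop :=
  (∀ x : S, x * x = x) ∧ ∀ x y : S, x * y * x = y * x

/-- A semigroup with a zero element `z` such that `x·x = z` and `x·y·x = z`. -/
def IsTNil (S : Type*) [Semigroup S] : Prop :=
  ∃ z : S, (∀ s : S, z * s = z ∧ s * z = z) ∧ (∀ x : S, x * x = z) ∧ ∀ x y : S, x * y * x = z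

namespace SLC

/-- `Pr A r B`: starting from the known set `A`, `r` multiplications yield the known set `B`. -/
inductive Pr {M : Type*} [Mul M] (A : Set M) : ℕ → Set M → Prop
  | base : Pr A 0 A
  | step {r : ℕ} {B : Set M} {x y : M} : Pr A r B → x ∈ B → y ∈ B → Pr A (r+1) (insert (x*y) B)

/-- `x` can be computed from `A` with at most `r` multiplications. -/
def Cst {M : Type*} [Mul M] (A : Set M) (r : ℕ) (x : M) : Prop :=
  ∃ r' ≤ r, ∃ B, Pr A r' B ∧ x ∈ B

section cost
variable {M : Type*}

theorem Pr.subset [Mul M] {A B : Set M} {r : ℕ} (h : Pr A r B) : A ⊆ B := by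
  induction h with
  | base => exact subset_rfl
  | step _ _ _ ih => exact ih.trans (Set.subset_insert _ _)

theorem Pr.trans [Mul M] {A B C : Set M} {r s : ℕ} (h : Pr A r B) (h' : Pr B s C) :
    Pr A (r+s) C := by
  induction h' with
  | base => simpa using h
  | step _ hx hy ih => exact Pr.step ih hx hy

theorem Pr.mono [Mul M] {A A' B : Set M} {r : ℕ} (h : Pr A r B) (hA : A ⊆ A') :
    Pr A' r (B ∪ A') := by
  induction h with
  | base => rw [Set.union_eq_self_of_subset_left hA]; exact Pr.base
  | step _ hx hy ih =>
    rw [Set.insert_union]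
    exact Pr.step ih (Or.inl hx) (Or.inl hy)

theorem Cst.of_mem [Mul M] {A : Set M} {x : M} (r : ℕ) (h : x ∈ A) : Cst A r x :=
  ⟨0, Nat.zero_le _, A, Pr.base, h⟩

theorem Cst.le [Mul M] {A : Set M} {x : M} {r s : ℕ} (h : Cst A r x) (hrs : r ≤ s) : Cst A s x := by
  obtain ⟨r', h1, B, h2, h3⟩ := h
  exact ⟨r', h1.trans hrs, B, h2, h3⟩

theorem Cst.mono [Mul M] {A A' : Set M} {x : M} {r : ℕ} (h : Cst A r x) (hA : A ⊆ A') :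
    Cst A' r x := by
  obtain ⟨r', h1, B, h2, h3⟩ := h
  exact ⟨r', h1, _, h2.mono hA, Or.inl h3⟩

theorem Cst.bind [Mul M] {A : Set M} {x y : M} {r s : ℕ} (h : Cst A r x)
    (h' : Cst (insert x A) s y) : Cst A (r+s) y := by
  obtain ⟨r', h1, B, h2, h3⟩ := h
  obtain ⟨s', g1, C, g2, g3⟩ := h'
  have : insert x A ⊆ B := Set.insert_subset h3 h2.subset
  exact ⟨r' + s', by omega, _, h2.trans (g2.mono this), Or.inl g3⟩

theorem Cst.mul [Mul M] {A : Set M} {x y : M} {r s : ℕ} (h : Cst A r x)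
    (h' : Cst A s y) : Cst A (r+s+1) (x*y) := by
  obtain ⟨r', h1, B, h2, h3⟩ := h
  obtain ⟨s', g1, C, g2, g3⟩ := h'
  exact ⟨r' + s' + 1, by omega, _, (h2.trans (g2.mono h2.subset)).step (Or.inr h3) (Or.inl g3),
    Set.mem_insert _ _⟩

theorem Cst.pow_aux [Monoid M] {A : Set M} {x : M} (h : x ∈ A) (h1 : 1 ∈ A) (m : ℕ) :
    Cst A (2 * Nat.log 2 m) (x ^ m) := by
  induction m using Nat.strong_induction_on with
  | _ m ih =>
    rcases Nat.lt_or_ge m 2 with hm | hm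
    · interval_cases m
      · simpa using Cst.of_mem _ h1
      · simpa using Cst.of_mem _ h
    · have hl : Nat.log 2 m = Nat.log 2 (m/2) + 1 := Nat.log_of_one_lt_of_le (by norm_num) hm
      have i := ih (m/2) (by omega)
      have : Cst (insert (x^(m/2)) A) 1 (x^(m/2) * x^(m/2)) :=
        (Cst.of_mem 0 (Set.mem_insert _ _)).mul (Cst.of_mem 0 (Set.mem_insert _ _))
      have j := i.bind this
      rcases Nat.even_or_odd' m with ⟨q, hq | hq⟩
      · have e : m / 2 = q := by omega
        rw [e] at j hl
        rw [hl, hq, two_mul q, pow_add]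
        exact j.le (by omega)
      · have e : m / 2 = q := by omega
        rw [e] at j hl
        rw [hl, hq, two_mul q, pow_succ, pow_add]
        exact (j.mul (Cst.of_mem 0 h)).le (by omega)

theorem Cst.pow [Monoid M] {A : Set M} {x : M} {r : ℕ} (h : Cst A r x) (h1 : 1 ∈ A) (m : ℕ) :
    Cst A (r + 2 * Nat.log 2 m) (x ^ m) :=
  h.bind (Cst.pow_aux (Set.mem_insert _ _) (Set.mem_insert_of_mem _ h1) m)

theorem Cst.list_prod [Monoid M] {A : Set M} {r : ℕ} (h1 : 1 ∈ A) (l : List M)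
    (h : ∀ x ∈ l, Cst A r x) : Cst A (l.length * (r+1)) l.prod := by
  induction l with
  | nil => simpa using Cst.of_mem _ h1
  | cons a l ih =>
    rw [List.prod_cons, List.length_cons]
    exact ((h a (by simp)).mul (ih fun x hx => h x (by simp [hx]))).le (by ring_nf; omega)

/-- Babai–Szemerédi reachability. -/
theorem bsz_aux [Monoid M] {G : Type*} [Group G] [Fintype G] (f : G → M)
    (hf : ∀ a b, f (a*b) = f a * f b) (T : Set G) (A : Set M) (D : ℕ)
    (hD : ∀ x ∈ T, Cst A D (f x)) (h1 : 1 ∈ A) (hf1 : f 1 ∈ A) (g : G)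
    (hg : g ∈ Submonoid.closure T) (j : ℕ) : ∀ (s : ℕ) (_ : s + j = Nat.log 2 (Fintype.card G) + 1)
    (K : Finset G) (_ : K.card = 2^s) (B : Set M) (_ : A ⊆ B)
    (_ : ∀ k ∈ K, Cst B s (f k) ∧ Cst B s (f k⁻¹)),
    Cst B (j * (D + 4 * Nat.log 2 (Fintype.card G) + 4)) (f g) := by
  classical
  have fpow : ∀ (z : G) (m : ℕ), 0 < m → f (z^m) = (f z)^m := by
    intro z m hm
    induction m with
    | zero => omega
    | succ m ih =>
      rcases Nat.eq_zero_or_pos m with h | h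
      · simp [h]
      · rw [pow_succ, hf, ih h, pow_succ]
  set L := Nat.log 2 (Fintype.card G) with hL
  induction j with
  | zero =>
    intro s hs K hK
    have : K.card ≤ Fintype.card G := Finset.card_le_univ K
    have h2 : Fintype.card G < 2^(L+1) := Nat.lt_pow_succ_log_self (by norm_num) _
    simp at hs
    subst hs
    omega
  | succ j ih =>
    intro s hs K hK B hAB hKB
    by_cases hcl : ∀ u, (∃ a ∈ K, ∃ b ∈ K, u = a⁻¹ * b) → ∀ x ∈ T, ∃ a ∈ K, ∃ b ∈ K, u * x = a⁻¹ * b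
    · have hne : K.Nonempty := by
        rw [← Finset.card_pos, hK]; positivity
      obtain ⟨k0, hk0⟩ := hne
      have : ∃ a ∈ K, ∃ b ∈ K, g = a⁻¹ * b := by
        clear ih
        induction hg using Submonoid.closure_induction_right with
        | one => exact ⟨k0, hk0, k0, hk0, by simp⟩
        | mul_right x hx y hy ih2 => exact hcl _ ih2 y hy
      obtain ⟨a, ha, b, hb, rfl⟩ := this
      rw [hf]
      refine ((hKB a ha).2.mul (hKB b hb).1).le ?_
      rw [add_mul]
      omega
    · push Not at hcl
      obtain ⟨u, ⟨a, ha, b, hb, rfl⟩, x, hx, hux⟩ := hcl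
      set z := a⁻¹ * b * x with hz
      have cz : Cst B (s + s + 1 + D + 1) (f z) := by
        rw [hz, hf, hf]
        exact ((hKB a ha).2.mul (hKB b hb).1).mul ((hD x hx).mono hAB)
      have czi : Cst (insert (f z) B) (2 * L) (f z⁻¹) := by
        have e : z⁻¹ = z^(Fintype.card G - 1) := by
          have hp : 0 < Fintype.card G := Fintype.card_pos
          rw [inv_eq_iff_mul_eq_one, ← pow_succ', Nat.sub_add_cancel hp, pow_card_eq_one]
        rcases Nat.eq_zero_or_pos (Fintype.card G - 1) with h0 | h0
        · rw [e, h0, pow_zero]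
          exact Cst.of_mem _ (Set.mem_insert_of_mem _ (hAB hf1))
        · rw [e, fpow _ _ h0]
          refine (Cst.pow_aux (Set.mem_insert _ _) (Set.mem_insert_of_mem _ (hAB h1)) _).le ?_
          have := Nat.log_mono_right (b := 2) (Nat.sub_le (Fintype.card G) 1)
          omega
      have main : Cst (insert (f z⁻¹) (insert (f z) B)) (j * (D + 4 * L + 4)) (f g) := by
        have hd : Disjoint K (K.image (· * z)) := by
          rw [Finset.disjoint_left]
          intro y hy hy'
          obtain ⟨k, hk, rfl⟩ := Finset.mem_image.1 hy'
          exact hux k hk _ hy (by simp)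
        refine ih (s+1) (by omega) (K ∪ K.image (· * z)) ?_ _ ?_ ?_
        · rw [Finset.card_union_of_disjoint hd,
            Finset.card_image_of_injective _ (mul_left_injective z), hK]
          ring
        · exact hAB.trans ((Set.subset_insert _ _).trans (Set.subset_insert _ _))
        · have hB : B ⊆ insert (f z⁻¹) (insert (f z) B) :=
            (Set.subset_insert _ _).trans (Set.subset_insert _ _)
          intro k hk
          rcases Finset.mem_union.1 hk with hk | hk
          · exact ⟨((hKB k hk).1.mono hB).le (by omega), ((hKB k hk).2.mono hB).le (by omega)⟩
          · obtain ⟨k, hk2, rfl⟩ := Finset.mem_image.1 hk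
            constructor
            · rw [hf k z]
              exact ((hKB k hk2).1.mono hB).mul (Cst.of_mem (x := f z) 0 (by simp))
            · rw [mul_inv_rev k z, hf z⁻¹ k⁻¹]
              exact ((Cst.of_mem (x := f z⁻¹) 0 (by simp)).mul ((hKB k hk2).2.mono hB)).le (le_of_eq (by ring))
      refine (cz.bind (czi.bind main)).le ?_
      rw [add_mul]
      omega

theorem bsz [Monoid M] {G : Type*} [Group G] [Fintype G] (f : G → M)
    (hf : ∀ a b, f (a*b) = f a * f b) (T : Set G) (A : Set M) (D : ℕ)
    (hD : ∀ x ∈ T, Cst A D (f x)) (h1 : 1 ∈ A) (hf1 : f 1 ∈ A) (g : G)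
    (hg : g ∈ Submonoid.closure T) :
    Cst A ((Nat.log 2 (Fintype.card G) + 1) * (D + 4 * Nat.log 2 (Fintype.card G) + 4)) (f g) := by
  refine bsz_aux f hf T A D hD h1 hf1 g hg _ 0 (by simp) {1} (by simp) A subset_rfl ?_
  simp only [Finset.mem_singleton, forall_eq, inv_one, and_self]
  exact Cst.of_mem _ hf1

/-- idempotent powers -/
theorem exists_idem_pow [Monoid M] [Fintype M] (x : M) :
    ∃ m, 1 ≤ m ∧ m ≤ (Fintype.card M + 1)^2 ∧ x^m * x^m = x^m := by
  have : ¬ Function.Injective (fun i : Fin (Fintype.card M + 1) => x ^ (i.1+1)) := by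
    intro h
    have := Fintype.card_le_of_injective _ h
    simp at this
  rw [Function.not_injective_iff] at this
  obtain ⟨i, j, hij, hne⟩ := this
  wlog hlt : i < j generalizing i j
  · exact this j i hij.symm hne.symm (lt_of_le_of_ne (not_lt.1 hlt) hne.symm)
  have hlt' : i.1 < j.1 := hlt
  have hj := j.2
  obtain ⟨p, hp⟩ : ∃ p, j.1 = i.1 + p := ⟨j.1 - i.1, by omega⟩
  have per : ∀ a, x^(i.1 + 1 + a * p) = x^(i.1+1) := by
    intro a
    induction a with
    | zero => simp
    | succ a ih =>
      have h0 : x^(i.1+1+p) = x^(i.1+1) := by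
        have := hij.symm
        simp only [hp] at this
        rw [show i.1 + 1 + p = i.1 + p + 1 by omega]; exact this
      rw [show i.1 + 1 + (a+1)*p = (i.1+1+p) + a * p by ring, pow_add, h0, ← pow_add, ih]
  have per2 : ∀ b a, x^(i.1 + 1 + b + a * p) = x^(i.1+1+b) := by
    intro b a
    rw [show i.1 + 1 + b + a * p = (i.1 + 1 + a * p) + b by ring, pow_add, per, ← pow_add]
  have hp1 : 1 ≤ p := by omega
  refine ⟨(i.1+1)*p, Nat.mul_pos (by omega) hp1, ?_, ?_⟩
  · rw [sq]; exact Nat.mul_le_mul (by omega) (by omega)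
  · rw [← pow_add]
    obtain ⟨b, hb⟩ : ∃ b, (i.1+1)*p = i.1+1+b :=
      ⟨(i.1+1)*p - (i.1+1), by have := Nat.le_mul_of_pos_right (i.1+1) hp1; omega⟩
    have := per2 b (i.1+1)
    rw [← hb] at this
    exact this

end cost


/-- Structural hypotheses (the non-permutation case). -/
structure Good (M : Type*) [Monoid M] (k : ℕ) : Prop where
  k3 : 3 ≤ k
  nu : ∀ x y : M, x * y = 1 → x = 1 ∧ y = 1
  ha : ∀ e f a : M, e ≠ 1 → f ≠ 1 → e * e = e → f * f = f → (e*a*f)^k = e*a*f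
  rr : ∀ e f g : M, e ≠ 1 → e * e = e → e * f = f → f * e = f → e * g = g → g * e = g →
    f * f = f → g * g = g → f * g = g → g * f = f → f = g
  ll : ∀ e f g : M, e ≠ 1 → e * e = e → e * f = f → f * e = f → e * g = g → g * e = g →
    f * f = f → g * g = g → f * g = f → g * f = g → f = g

/-- `s` acts invertibly at the idempotent `h`. -/
def St {M : Type*} [Monoid M] (h s : M) : Prop := ∃ y, h * s * y * h = h

section struct
variable {M : Type*} [Monoid M] {k : ℕ}

theorem pow_hsh {h s : M} (hh : h * h = h) (m : ℕ) : (h*s*h)^(m+1) = (h*s)^(m+1) * h := by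
  induction m with
  | zero => simp
  | succ m ih =>
    rw [pow_succ, ih, pow_succ (h*s) (m+1)]
    simp only [mul_assoc]
    rw [← mul_assoc h h, hh]

theorem Good.ne_left (H : Good M k) {x : M} (y : M) (hx : x ≠ 1) : x * y ≠ 1 :=
  fun h => hx (H.nu _ _ h).1

theorem Good.ne_right (H : Good M k) {y : M} (x : M) (hy : y ≠ 1) : x * y ≠ 1 :=
  fun h => hy (H.nu _ _ h).2

theorem Good.st_pow (H : Good M k) {h s : M} (h1 : h ≠ 1) (hh : h * h = h) (hs : St h s) :
    (h*s*h)^(k-1) = h := by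
  obtain ⟨y, hy⟩ := hs
  have hk := H.k3
  have i1 : y*h*s ≠ 1 := H.ne_left _ (H.ne_right _ h1)
  have i2 : (y*h*s)*(y*h*s) = y*h*s := by
    calc (y*h*s)*(y*h*s) = y*(h*s*y*h)*s := by simp only [mul_assoc]
      _ = y*h*s := by rw [hy]
  have e := H.ha h (y*h*s) (h*s) h1 i1 hh i2
  have e2 : h*(h*s)*(y*h*s) = h*s := by
    calc h*(h*s)*(y*h*s) = h*(h*s*y*h)*s := by simp only [mul_assoc]
      _ = h*s := by rw [hy, hh]
  rw [e2] at e
  obtain ⟨j, rfl⟩ : ∃ j, k = j + 2 := ⟨k-2, by omega⟩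
  rw [show j + 2 - 1 = j + 1 by omega, pow_hsh hh]
  calc (h*s)^(j+1)*h = (h*s)^(j+1)*(h*s*y*h) := by rw [hy]
    _ = (h*s)^(j+2)*(y*h) := by rw [pow_succ (h*s) (j+1)]; simp only [mul_assoc]
    _ = h*s*y*h := by rw [e]; simp only [mul_assoc]
    _ = h := hy

theorem Good.st_right (H : Good M k) {h a b : M} (h1 : h ≠ 1) (hh : h * h = h)
    (hs : St h (a*b)) : St h b := by
  obtain ⟨y, hy⟩ := hs
  have hk := H.k3
  have i1 : b*y*h*a ≠ 1 := H.ne_left _ (H.ne_right _ h1)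
  have i2 : (b*y*h*a)*(b*y*h*a) = b*y*h*a := by
    calc (b*y*h*a)*(b*y*h*a) = b*y*(h*(a*b)*y*h)*a := by simp only [mul_assoc]
      _ = b*y*h*a := by rw [hy]
  have e := H.ha (b*y*h*a) h (b*y*h) i1 h1 i2 hh
  have e2 : (b*y*h*a)*(b*y*h)*h = b*y*h := by
    calc (b*y*h*a)*(b*y*h)*h = b*y*(h*(a*b)*y*h)*h := by simp only [mul_assoc]
      _ = b*y*h := by rw [hy, mul_assoc, hh]
  rw [e2] at e
  obtain ⟨j, rfl⟩ : ∃ j, k = j + 2 := ⟨k-2, by omega⟩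
  refine ⟨y * (h*b*y)^j, ?_⟩
  have c : ∀ m, (h*b*y)^m*h = h*(b*y*h)^m := by
    intro m
    induction m with
    | zero => simp
    | succ m ih =>
      calc (h*b*y)^(m+1)*h = (h*b*y)*((h*b*y)^m*h) := by rw [pow_succ', mul_assoc]
        _ = (h*b*y)*(h*(b*y*h)^m) := by rw [ih]
        _ = h*(b*y*h)^(m+1) := by rw [pow_succ']; simp only [mul_assoc]
  calc h*b*(y*(h*b*y)^j)*h = (h*b*y)^(j+1)*h := by rw [pow_succ']; simp only [mul_assoc]
    _ = h*(b*y*h)^(j+1) := c _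
    _ = (h*(a*b)*y*h)*(b*y*h)^(j+1) := by rw [hy]
    _ = h*a*(b*y*h)^(j+2) := by rw [pow_succ' _ (j+1)]; simp only [mul_assoc]
    _ = h*(a*b)*y*h := by rw [e]; simp only [mul_assoc]
    _ = h := hy

theorem st_left {h a b : M} (hs : St h (a*b)) : St h a := by
  obtain ⟨y, hy⟩ := hs
  exact ⟨b*y, by simpa only [mul_assoc] using hy⟩

theorem Good.st_factor (H : Good M k) {h : M} (a c b : M) (h1 : h ≠ 1) (hh : h * h = h)
    (hs : St h (a*c*b)) : St h c :=
  H.st_right h1 hh (st_left hs)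

theorem st_one {h : M} (hh : h * h = h) : St h 1 := ⟨1, by simpa using hh⟩

/-- the inverse in the group at `h` -/
def iv (k : ℕ) (z : M) : M := z^(k-2)

theorem Good.iv_spec (H : Good M k) {h s : M} (h1 : h ≠ 1) (hh : h * h = h) (hs : St h s) :
    (h*s*h) * iv k (h*s*h) = h ∧ iv k (h*s*h) * (h*s*h) = h ∧
    h * iv k (h*s*h) = iv k (h*s*h) ∧ iv k (h*s*h) * h = iv k (h*s*h) := by
  have hk := H.k3
  have e := H.st_pow h1 hh hs
  obtain ⟨j, rfl⟩ : ∃ j, k = j + 3 := ⟨k-3, by omega⟩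
  unfold iv
  rw [show j + 3 - 1 = j + 1 + 1 by omega] at e
  rw [show j + 3 - 2 = j + 1 by omega]
  refine ⟨by rw [← pow_succ', e], by rw [← pow_succ, e], ?_, ?_⟩
  · rw [pow_succ']; simp only [← mul_assoc]; rw [hh]
  · rw [pow_succ]; simp only [mul_assoc]; rw [hh]

/-- idempotent in the `R`-class of `h` -/
def gam (k : ℕ) (h v : M) : M := iv k (h*v*h) * h * v

/-- idempotent in the `L`-class of `h` -/
def gam' (k : ℕ) (h v : M) : M := v * h * iv k (h*v*h)

theorem Good.gam_spec (H : Good M k) {h v : M} (h1 : h ≠ 1) (hh : h * h = h) (hs : St h v) :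
    h * gam k h v = gam k h v ∧ gam k h v * h = h ∧ gam k h v * gam k h v = gam k h v ∧
    h * v = h * v * h * gam k h v := by
  obtain ⟨a, b, c, d⟩ := H.iv_spec h1 hh hs
  have q : gam k h v * h = h := by
    unfold gam
    calc iv k (h*v*h) * h * v * h = iv k (h*v*h) * (h*v*h) := by
          simp only [mul_assoc]
      _ = h := b
  refine ⟨?_, q, ?_, ?_⟩
  · unfold gam; rw [← mul_assoc, ← mul_assoc, c]
  · have : gam k h v = h * gam k h v := by unfold gam; rw [← mul_assoc, ← mul_assoc, c]
    calc gam k h v * gam k h v = gam k h v * (h * gam k h v) := by rw [← this]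
      _ = gam k h v := by rw [← mul_assoc, q, ← this]
  · unfold gam
    rw [← mul_assoc, ← mul_assoc, a, hh]

theorem Good.gam'_spec (H : Good M k) {h v : M} (h1 : h ≠ 1) (hh : h * h = h) (hs : St h v) :
    gam' k h v * h = gam' k h v ∧ h * gam' k h v = h ∧ gam' k h v * gam' k h v = gam' k h v ∧
    v * h = gam' k h v * (h * v * h) := by
  obtain ⟨a, b, c, d⟩ := H.iv_spec h1 hh hs
  have q : h * gam' k h v = h := by
    unfold gam'
    rw [← mul_assoc, ← mul_assoc, a]
  have r : gam' k h v * h = gam' k h v := by unfold gam'; rw [mul_assoc, d]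
  refine ⟨r, q, ?_, ?_⟩
  · calc gam' k h v * gam' k h v = gam' k h v * h * gam' k h v := by rw [r]
      _ = gam' k h v := by rw [mul_assoc, q, r]
  · unfold gam'
    rw [mul_assoc, b, mul_assoc, hh]

theorem Good.st_mul (H : Good M k) {h s s' : M} (h1 : h ≠ 1) (hh : h * h = h)
    (hs : St h s) (hs' : St h s') : St h (s*s') := by
  have hk := H.k3
  obtain ⟨a1, a2, a3, a4⟩ := H.gam_spec h1 hh hs
  obtain ⟨b1, b2, b3, b4⟩ := H.gam'_spec h1 hh hs'
  have hi := (H.iv_spec h1 hh hs).2.2.1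
  set g := gam k h s with hg
  set g' := gam' k h s' with hg'
  have n1 : g ≠ 1 := fun e => h1 (by rw [e, one_mul] at a2; rw [e, mul_one] at a1; exact a1)
  have n2 : g' ≠ 1 := fun e => h1 (by rw [e, one_mul] at b1; exact b1)
  have e := H.ha g' g 1 n2 n1 b3 a3
  rw [mul_one] at e
  obtain ⟨j, rfl⟩ : ∃ j, k = j + 2 := ⟨k-2, by omega⟩
  have sw : ∀ m, (g'*g)^(m+1) = g'*(g*g')^m*g := by
    intro m
    induction m with
    | zero => simp
    | succ m ih => rw [pow_succ, ih, pow_succ]; simp only [mul_assoc]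
  rw [show j + 2 = (j+1)+1 by omega, sw] at e
  have f : h = h * (g*g')^(j+1) * h := by
    calc h = h * h := hh.symm
      _ = (h * g') * (g * h) := by rw [a2, b2]
      _ = h * (g' * g) * h := by simp only [mul_assoc]
      _ = h * (g' * (g*g')^(j+1) * g) * h := by rw [e]
      _ = (h * g') * (g*g')^(j+1) * (g * h) := by simp only [mul_assoc]
      _ = h * (g*g')^(j+1) * h := by rw [a2, b2]
  rw [pow_succ'] at f
  refine H.st_factor (iv (j+2) (h*s*h) * h) (s*s') (h * iv (j+2) (h*s'*h)) h1 hh ⟨(g*g')^j, ?_⟩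
  conv_rhs => rw [f]
  rw [hg, hg']
  unfold gam gam'
  simp only [mul_assoc]

theorem Good.st_list (H : Good M k) {h : M} (h1 : h ≠ 1) (hh : h * h = h) (l : List M)
    (hl : ∀ x ∈ l, St h x) : St h l.prod := by
  induction l with
  | nil => exact st_one hh
  | cons a l ih =>
    rw [List.prod_cons]
    exact H.st_mul h1 hh (hl a (by simp)) (ih fun x hx => hl x (by simp [hx]))

theorem Good.st_of_list (H : Good M k) {h : M} (h1 : h ≠ 1) (hh : h * h = h) (l : List M)
    (hl : St h l.prod) : ∀ x ∈ l, St h x := by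
  intro x hx
  obtain ⟨l1, l2, rfl⟩ := List.append_of_mem hx
  rw [List.prod_append, List.prod_cons, ← mul_assoc] at hl
  exact H.st_factor _ _ _ h1 hh hl

theorem Good.st_pow' (H : Good M k) {h s : M} (h1 : h ≠ 1) (hh : h * h = h) (hs : St h s) (m : ℕ) :
    St h (s^m) := by
  induction m with
  | zero => simpa using st_one hh
  | succ m ih => rw [pow_succ]; exact H.st_mul h1 hh ih hs

theorem Good.gam_idem (H : Good M k) {h e y y' : M} (h1 : h ≠ 1) (hh : h * h = h) (e1 : e ≠ 1)
    (ee : e * e = e) (hs : St h (y*e)) (hs' : St h (y'*e)) : gam k h (y*e) = gam k h (y'*e) := by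
  obtain ⟨a1, a2, a3, -⟩ := H.gam_spec h1 hh hs
  obtain ⟨b1, b2, b3, -⟩ := H.gam_spec h1 hh hs'
  have ae : gam k h (y*e) * e = gam k h (y*e) := by unfold gam; simp only [mul_assoc]; rw [ee]
  have be : gam k h (y'*e) * e = gam k h (y'*e) := by unfold gam; simp only [mul_assoc]; rw [ee]
  set g := gam k h (y*e)
  set g' := gam k h (y'*e)
  have c : g * g' = g' := by rw [← b1, ← mul_assoc, a2]
  have d : g' * g = g := by rw [← a1, ← mul_assoc, b2]
  have q : ∀ u v : M, u * e = u → (e * u) * (e * v) = e * (u * v) := by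
    intro u v hu
    calc (e * u) * (e * v) = e * (u * e) * v := by simp only [mul_assoc]
      _ = e * (u * v) := by rw [hu, mul_assoc]
  have key : e * g = e * g' := by
    refine H.rr e (e*g) (e*g') e1 ee ?_ ?_ ?_ ?_ ?_ ?_ ?_ ?_
    · rw [← mul_assoc, ee]
    · rw [mul_assoc, ae]
    · rw [← mul_assoc, ee]
    · rw [mul_assoc, be]
    · rw [q _ _ ae, a3]
    · rw [q _ _ be, b3]
    · rw [q _ _ ae, c]
    · rw [q _ _ be, d]
  calc g = g * e * g := by rw [ae, a3]
    _ = g * (e * g') := by rw [mul_assoc, key]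
    _ = g' := by rw [← mul_assoc, ae, c]

theorem Good.gam'_idem (H : Good M k) {h e y y' : M} (h1 : h ≠ 1) (hh : h * h = h) (e1 : e ≠ 1)
    (ee : e * e = e) (hs : St h (e*y)) (hs' : St h (e*y')) : gam' k h (e*y) = gam' k h (e*y') := by
  obtain ⟨a1, a2, a3, -⟩ := H.gam'_spec h1 hh hs
  obtain ⟨b1, b2, b3, -⟩ := H.gam'_spec h1 hh hs'
  have ae : e * gam' k h (e*y) = gam' k h (e*y) := by unfold gam'; simp only [← mul_assoc]; rw [ee]
  have be : e * gam' k h (e*y') = gam' k h (e*y') := by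
    unfold gam'; simp only [← mul_assoc]; rw [ee]
  set g := gam' k h (e*y)
  set g' := gam' k h (e*y')
  have c : g * g' = g := by rw [← a1, mul_assoc, b2]
  have d : g' * g = g' := by rw [← b1, mul_assoc, a2]
  have q : ∀ u v : M, e * v = v → (u * e) * (v * e) = (u * v) * e := by
    intro u v hu
    calc (u * e) * (v * e) = u * (e * v) * e := by simp only [mul_assoc]
      _ = (u * v) * e := by rw [hu]
  have key : g * e = g' * e := by
    refine H.ll e (g*e) (g'*e) e1 ee ?_ ?_ ?_ ?_ ?_ ?_ ?_ ?_
    · rw [← mul_assoc, ae]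
    · rw [mul_assoc, ee]
    · rw [← mul_assoc, be]
    · rw [mul_assoc, ee]
    · rw [q _ _ ae, a3]
    · rw [q _ _ be, b3]
    · rw [q _ _ be, c]
    · rw [q _ _ ae, d]
  calc g = g * e * g := by rw [mul_assoc, ae, a3]
    _ = g' * (e * g) := by rw [key, mul_assoc]
    _ = g' := by rw [ae, d]

/-- key claim: `h y v = (h y v h) γ(v)` when `v` has an idempotent factor -/
theorem Good.long_right (H : Good M k) {h a e b y : M} (h1 : h ≠ 1) (hh : h * h = h) (e1 : e ≠ 1)
    (ee : e * e = e) (ha : St h a) (he : St h e) (hb : St h b) (hy : St h y) :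
    h * y * (a*e*b) = h * y * (a*e*b) * h * gam k h (a*e*b) := by
  have hae := H.st_mul h1 hh ha he
  have haeb := H.st_mul h1 hh hae hb
  have hyae : St h ((y*a)*e) := H.st_mul h1 hh (H.st_mul h1 hh hy ha) he
  have i := H.gam_idem h1 hh e1 ee hyae hae
  have s1 := (H.gam_spec h1 hh hyae).2.2.2
  have s2 := (H.gam_spec h1 hh haeb).2.2.2
  rw [i] at s1
  have s3 : gam k h (a*e) * b = gam k h (a*e) * b * h * gam k h (a*e*b) := by
    calc gam k h (a*e) * b = iv k (h*(a*e)*h) * (h * (a*e*b)) := by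
          unfold gam; simp only [mul_assoc]
      _ = iv k (h*(a*e)*h) * (h * (a*e*b) * h * gam k h (a*e*b)) := by rw [← s2]
      _ = _ := by
          rw [show gam k h (a*e) * b = iv k (h*(a*e)*h) * (h * (a*e*b)) by
            unfold gam; simp only [mul_assoc]]
          simp only [mul_assoc]
  have s4 : h * y * (a*e*b) = h * (y*a*e) * h * (gam k h (a*e) * b) := by
    rw [← mul_assoc (h * (y*a*e) * h), ← s1]; simp only [mul_assoc]
  rw [s4]
  conv_lhs => rw [s3]
  simp only [mul_assoc]

theorem Good.long_left (H : Good M k) {h a e b y : M} (h1 : h ≠ 1) (hh : h * h = h) (e1 : e ≠ 1)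
    (ee : e * e = e) (ha : St h a) (he : St h e) (hb : St h b) (hy : St h y) :
    (a*e*b) * y * h = gam' k h (a*e*b) * (h * (a*e*b) * y * h) := by
  have heb := H.st_mul h1 hh he hb
  have haeb : St h (a*(e*b)) := H.st_mul h1 hh ha heb
  have heby : St h (e*(b*y)) := H.st_mul h1 hh he (H.st_mul h1 hh hb hy)
  have i := H.gam'_idem h1 hh e1 ee heby heb
  have s1 := (H.gam'_spec h1 hh heby).2.2.2
  have s2 := (H.gam'_spec h1 hh haeb).2.2.2
  rw [i] at s1
  have s0 : a * gam' k h (e*b) = a*(e*b)*h * iv k (h*(e*b)*h) := by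
    unfold gam'; simp only [mul_assoc]
  have s3 : a * gam' k h (e*b) = gam' k h (a*(e*b)) * h * (a * gam' k h (e*b)) := by
    conv_lhs => rw [s0, s2]
    rw [s0]
    simp only [mul_assoc]
  have s4 : (a*e*b) * y * h = a * gam' k h (e*b) * (h * (e*(b*y)) * h) := by
    rw [mul_assoc a (gam' k h (e*b)), ← s1]; simp only [mul_assoc]
  have s5 : a*e*b = a*(e*b) := mul_assoc _ _ _
  have s6 : h * (a*e*b) * y * h = h * ((a*e*b) * y * h) := by simp only [mul_assoc]
  rw [s6, s4]
  conv_lhs => rw [s3]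
  rw [s5]
  simp only [mul_assoc]

end struct

section descent
variable {M : Type*} [Monoid M] {k : ℕ}

theorem Good.core (H : Good M k) {h e e' b x a' u v u' v' va ve vb wa we wb : M}
    (h1 : h ≠ 1) (hh : h * h = h) (e1 : e ≠ 1) (ee : e * e = e) (e1' : e' ≠ 1) (ee' : e' * e' = e')
    (se : St h e) (se' : St h e') (sb : St h b) (sx : St h x) (sa : St h a')
    (su : St h u) (su' : St h u')
    (hv : v = va * ve * vb) (sva : St h va) (sve : St h ve) (svb : St h vb)
    (ve1 : ve ≠ 1) (vee : ve * ve = ve)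
    (hw : v' = wa * we * wb) (swa : St h wa) (swe : St h we) (swb : St h wb)
    (we1 : we ≠ 1) (wee : we * we = we)
    (huv : e * b = u * v) (huv' : a' * e' = v' * u')
    (hst : ∀ f : M, f ≠ 1 → f * f = f → St f (e*b*x*a'*e') → St f h) :
    e*b*x*a'*e' = e*b*(gam k h v * x * gam' k h v')*a'*e' := by
  have hk := H.k3
  set c := e*b*x*a'*e' with hc
  have ck : c^k = c := by
    have := H.ha e e' (b*x*a') e1 e1' ee ee'
    simpa only [hc, mul_assoc] using this
  obtain ⟨j, rfl⟩ : ∃ j, k = j + 3 := ⟨k-3, by omega⟩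
  set f := c^(j+2) with hf
  have fc : f * c = c := by rw [hf, ← pow_succ, ck]
  have cf : c * f = c := by rw [hf, ← pow_succ', ck]
  have ff : f * f = f := by
    conv_lhs => rhs; rw [hf, pow_succ']
    rw [← mul_assoc, fc, ← pow_succ']
  have c1 : c ≠ 1 := H.ne_right _ e1'
  have f1 : f ≠ 1 := by
    rw [hf, pow_succ]; exact H.ne_right _ c1
  have sfc : St f c := ⟨c^(j+1), by rw [fc, ← pow_succ', ← hf, ff]⟩
  have sfh := hst f f1 ff sfc
  have sc : St h c := H.st_mul h1 hh (H.st_mul h1 hh (H.st_mul h1 hh (H.st_mul h1 hh se sb) sx) sa) se'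
  have sf : St h f := H.st_pow' h1 hh sc _
  have ec : e * c = c := by rw [hc]; simp only [← mul_assoc]; rw [ee]
  have ce : c * e' = c := by rw [hc, mul_assoc, ee']
  have ef : e * f = f := by rw [hf, pow_succ', ← mul_assoc, ec]
  have fe : f * e' = f := by rw [hf, pow_succ, mul_assoc, ce]
  set ge := gam' (j+3) h e with hge
  set ge' := gam (j+3) h e' with hge'
  obtain ⟨p1, p2, p3, p4⟩ := H.gam'_spec h1 hh se
  obtain ⟨q1, q2, q3, q4⟩ := H.gam_spec h1 hh se'
  rw [← hge] at p1 p2 p3 p4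
  rw [← hge'] at q1 q2 q3 q4
  have L1 : ∀ y, St h y → ge * (e * y * h) = e * y * h := by
    intro y hy
    have := H.long_left (a := 1) (b := 1) h1 hh e1 ee (st_one hh) se (st_one hh) hy
    rw [one_mul, mul_one, ← hge] at this
    rw [this, ← mul_assoc, p3]
  have R1 : ∀ y, St h y → (h * y * e') * ge' = h * y * e' := by
    intro y hy
    have := H.long_right (a := 1) (b := 1) h1 hh e1' ee' (st_one hh) se' (st_one hh) hy
    rw [one_mul, mul_one, ← hge'] at this
    rw [this, mul_assoc, q3]
  have gc : ge * c = c := by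
    obtain ⟨y, hy⟩ := sfh
    have a1 : c = (e * f * h) * (y * f * c) := by
      rw [ef]
      calc c = f * c := fc.symm
        _ = (f * h * y * f) * c := by rw [hy]
        _ = _ := by simp only [mul_assoc]
    rw [a1, ← mul_assoc, L1 f sf]
  have cg : c * ge' = c := by
    have hp := H.st_pow f1 ff sfh
    rw [show j + 3 - 1 = (j+1)+1 by omega, pow_succ] at hp
    have a1 : c = (c * (f*h*f)^(j+1) * f) * (h * f * e') := by
      rw [mul_assoc h, fe]
      calc c = c * f := cf.symm
        _ = c * ((f*h*f)^(j+1) * (f*h*f)) := by rw [hp]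
        _ = _ := by simp only [mul_assoc]
    rw [a1, mul_assoc, R1 f sf]
  have cfin : c = ge * (h * c * h) * ge' := by
    calc c = ge * c * ge' := by rw [gc, cg]
      _ = (ge * h) * c * (h * ge') := by rw [p1, q1]
      _ = _ := by simp only [mul_assoc]
  have sv : St h v := hv ▸ H.st_mul h1 hh (H.st_mul h1 hh sva sve) svb
  have sv' : St h v' := hw ▸ H.st_mul h1 hh (H.st_mul h1 hh swa swe) swb
  obtain ⟨r1, r2, r3, r4⟩ := H.gam_spec h1 hh sv
  obtain ⟨s1, s2, s3, s4⟩ := H.gam'_spec h1 hh sv'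
  have A1 : h * (e * b) * gam (j+3) h v = h * (e*b) := by
    have := H.long_right h1 hh ve1 vee sva sve svb su
    rw [← hv] at this
    rw [huv, ← mul_assoc, this, mul_assoc _ (gam (j+3) h v), r3]
  have A2 : gam' (j+3) h v' * ((a' * e') * h) = (a'*e') * h := by
    have := H.long_left h1 hh we1 wee swa swe swb su'
    rw [← hw] at this
    rw [huv', this, ← mul_assoc, s3]
  have B1 : ge * h * (e * b * gam (j+3) h v) = e * b * gam (j+3) h v := by
    rw [p1, ← r1]
    have := L1 b sb
    calc ge * (e * b * (h * gam (j+3) h v)) = ge * (e * b * h) * gam (j+3) h v := by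
          simp only [mul_assoc]
      _ = _ := by rw [this]; simp only [mul_assoc]
  have B2 : (gam' (j+3) h v' * (a' * e')) * (h * ge') = gam' (j+3) h v' * (a' * e') := by
    rw [q1, ← s1]
    have := R1 a' sa
    calc gam' (j+3) h v' * h * (a' * e') * ge' = gam' (j+3) h v' * (h * a' * e' * ge') := by
          simp only [mul_assoc]
      _ = _ := by rw [this]; simp only [mul_assoc]
  rw [cfin]
  have m1 : h * c * h = (h * (e * b)) * x * ((a' * e') * h) := by rw [hc]; simp only [mul_assoc]
  rw [m1, ← A1, ← A2]
  calc _ = (ge * h * (e * b * gam (j+3) h v)) * x * ((gam' (j+3) h v' * (a' * e')) * (h * ge')) := by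
        simp only [mul_assoc]
    _ = _ := by rw [B1, B2]; simp only [mul_assoc]

theorem Good.prod_ne_one (H : Good M k) (l : List M) (x : M) (hx : x ∈ l) (h1 : x ≠ 1) :
    l.prod ≠ 1 := by
  obtain ⟨l1, l2, rfl⟩ := List.append_of_mem hx
  rw [List.prod_append, List.prod_cons]
  exact H.ne_right _ (H.ne_left _ h1)

theorem Good.pow_ne_one (H : Good M k) {x : M} (hx : x ≠ 1) {m : ℕ} (hm : 1 ≤ m) : x^m ≠ 1 := by
  obtain ⟨j, rfl⟩ : ∃ j, m = j + 1 := ⟨m-1, by omega⟩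
  rw [pow_succ]; exact H.ne_right _ hx

theorem Good.st_self_pow (H : Good M k) {x : M} (hx : x ≠ 1) {m : ℕ} (hm : 1 ≤ m)
    (hi : x^m * x^m = x^m) : St (x^m) x := by
  refine ⟨x^(m-1), ?_⟩
  rw [mul_assoc (x^m), ← pow_succ', Nat.sub_add_cancel hm, hi, hi]

theorem Good.descent [Fintype M] (H : Good M k) (Cl : List M) (hne : Cl ≠ [])
    (hC : ∀ x ∈ Cl, x ≠ 1) :
    ∃ D : Finset M, (∀ x ∈ D, x ∈ Cl) ∧ 2 ^ D.card ≤ Fintype.card M ∧ ∃ m, 1 ≤ m ∧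
      m ≤ (Fintype.card M + 1)^2 ∧ D.toList.prod ≠ 1 ∧ (D.toList.prod^m) * (D.toList.prod^m) = D.toList.prod^m ∧
      ∀ c ∈ Cl, St (D.toList.prod^m) c := by
  classical
  set Ok : Finset M → Prop := fun D => D ⊆ Cl.toFinset ∧ D.Nonempty ∧
    ∃ m, 1 ≤ m ∧ m ≤ (Fintype.card M + 1)^2 ∧
      (D.toList.prod^m) * (D.toList.prod^m) = D.toList.prod^m ∧
      ∀ c ∈ Cl, St (D.toList.prod^m) c with hOk
  have nn : ∀ D : Finset M, D ⊆ Cl.toFinset → D.Nonempty → D.toList.prod ≠ 1 := by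
    rintro D hD ⟨x, hx⟩
    exact H.prod_ne_one _ x (by simpa using hx) (hC x (by simpa using hD hx))
  have ex : ∃ D, Ok D := by
    refine ⟨Cl.toFinset, subset_rfl, by simpa using hne, ?_⟩
    have n1 := nn Cl.toFinset subset_rfl (by simpa using hne)
    obtain ⟨m, m1, m2, m3⟩ := exists_idem_pow (Cl.toFinset.toList.prod)
    refine ⟨m, m1, m2, m3, fun c hc => ?_⟩
    exact H.st_of_list (H.pow_ne_one n1 m1) m3 _ (H.st_self_pow n1 m1 m3) c (by simpa using hc)
  obtain ⟨D, hD, hmin⟩ := exists_minimalFor_of_wellFoundedLT Ok Finset.card ex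
  obtain ⟨d1, d2, m, m1, m2, m3, m4⟩ := hD
  have n1 := nn D d1 d2
  refine ⟨D, fun x hx => by simpa using d1 hx, ?_, m, m1, m2, n1, m3, m4⟩
  have key : ∀ I ⊆ D, ∀ J ⊆ D, I.toList.prod = J.toList.prod → I ⊆ J := by
    intro I hI J hJ hIJ i hi
    by_contra hiJ
    have hJ' : J ⊆ D.erase i := fun x hx => Finset.mem_erase.2 ⟨fun h => hiJ (h ▸ hx), hJ hx⟩
    have Jne : J.Nonempty := by
      rw [Finset.nonempty_iff_ne_empty]
      rintro rfl
      exact nn I (hI.trans d1) ⟨i, hi⟩ (by simpa using hIJ)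
    have n1' := nn (D.erase i) ((Finset.erase_subset _ _).trans d1) (Jne.mono hJ')
    obtain ⟨m', m1', m2', m3'⟩ := exists_idem_pow ((D.erase i).toList.prod)
    have h1 := H.pow_ne_one n1' m1'
    have se : ∀ c ∈ D.erase i, St ((D.erase i).toList.prod^m') c := fun c hc =>
      H.st_of_list h1 m3' _ (H.st_self_pow n1' m1' m3') c (by simpa using hc)
    set h' := (D.erase i).toList.prod^m' with hh'
    have sJ : St h' J.toList.prod := H.st_list h1 m3' _ fun x hx => se x (hJ' (by simpa using hx))
    rw [← hIJ] at sJ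
    have si : St h' i := H.st_of_list h1 m3' _ sJ i (by simpa using hi)
    have sD : St h' D.toList.prod := by
      refine H.st_list h1 m3' _ fun x hx => ?_
      by_cases hxi : x = i
      · rwa [hxi]
      · exact se x (Finset.mem_erase.2 ⟨hxi, by simpa using hx⟩)
    have sh := H.st_pow' h1 m3' sD m
    have : Ok (D.erase i) := by
      refine ⟨(Finset.erase_subset _ _).trans d1, Jne.mono hJ', m', m1', m2', m3', fun c hc => ?_⟩
      obtain ⟨y, hy⟩ := m4 c hc
      rw [← hy, mul_assoc _ y] at sh
      exact H.st_factor _ _ _ h1 m3' sh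
    have := hmin this (Finset.card_le_card (Finset.erase_subset _ _))
    have := Finset.card_erase_lt_of_mem (hI hi)
    omega
  rw [← Finset.card_powerset]
  rw [← Finset.card_univ]
  refine Finset.card_le_card_of_injOn (fun I => I.toList.prod) (fun _ _ => Finset.mem_univ _) ?_
  intro I hI J hJ h
  have hI' : I ⊆ D := by simpa using hI
  have hJ' : J ⊆ D := by simpa using hJ
  exact subset_antisymm (key I hI' J hJ' h) (key J hJ' I hI' h.symm)

end descent

section corner
variable {M : Type*} [Monoid M] {k : ℕ}

/-- membership in the maximal subgroup at `h` -/
def IsU (h x : M) : Prop :=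
  h * x = x ∧ x * h = x ∧ ∃ y, h * y = y ∧ y * h = y ∧ x * y = h ∧ y * x = h

/-- the local submonoid at `h` -/
def Cor (h : M) : Type _ := {x : M // h * x = x ∧ x * h = x}

/-- its monoid structure -/
@[reducible] def corMonoid (h : M) (hh : h * h = h) : Monoid (Cor h) where
  mul x y := ⟨x.1 * y.1, by rw [← mul_assoc, x.2.1], by rw [mul_assoc, y.2.2]⟩
  one := ⟨h, hh, hh⟩
  mul_assoc x y z := Subtype.ext (mul_assoc x.1 y.1 z.1)
  one_mul x := Subtype.ext x.2.1
  mul_one x := Subtype.ext x.2.2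

theorem bsz_corner [Fintype M] {h : M} (hh : h * h = h) (A : Set M) (h1 : 1 ∈ A) (hA : h ∈ A)
    (D : ℕ) (T : Set M) (hT : ∀ x ∈ T, Cst A D x ∧ IsU h x) (g : M)
    (hg : g ∈ Subsemigroup.closure T) :
    Cst A ((Nat.log 2 (Fintype.card M) + 1) * (D + 4 * Nat.log 2 (Fintype.card M) + 4)) g := by
  classical
  let := corMonoid h hh
  let f : (Cor h)ˣ → M := fun u => u.1.1
  have finj : Function.Injective f := fun a b hab => Units.ext (Subtype.ext hab)
  let : Fintype (Cor h)ˣ := Fintype.ofInjective f finj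
  have hf : ∀ a b, f (a*b) = f a * f b := fun a b => rfl
  have hf1 : f 1 = h := rfl
  have hcard : Fintype.card (Cor h)ˣ ≤ Fintype.card M := Fintype.card_le_of_injective f finj
  have hgg : ∃ u ∈ Submonoid.closure (f ⁻¹' T), f u = g := by
    induction hg using Subsemigroup.closure_induction with
    | mem x hx =>
      obtain ⟨-, a, b, y, c, d, e1, e2⟩ := hT x hx
      let u : (Cor h)ˣ := ⟨⟨x, a, b⟩, ⟨y, c, d⟩, Subtype.ext e1, Subtype.ext e2⟩
      exact ⟨u, Submonoid.subset_closure (show f u ∈ T from hx), rfl⟩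
    | mul x y _ _ ix iy =>
      obtain ⟨u, hu, rfl⟩ := ix
      obtain ⟨v, hv, rfl⟩ := iy
      exact ⟨u*v, mul_mem hu hv, rfl⟩
  obtain ⟨u, hu, rfl⟩ := hgg
  refine (bsz f hf (f ⁻¹' T) A D (fun x hx => (hT _ hx).1) h1 (by rw [hf1]; exact hA) u hu).le ?_
  have := Nat.log_mono_right (b := 2) hcard
  gcongr

theorem log_idem (N m : ℕ) (hm : m ≤ (N+1)^2) : Nat.log 2 m ≤ 2 * Nat.log 2 N + 2 := by
  have h2 : N < 2^(Nat.log 2 N+1) := Nat.lt_pow_succ_log_self (by norm_num) _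
  have : m ≤ 2^(2 * Nat.log 2 N + 2) := by
    calc m ≤ (N+1)^2 := hm
      _ ≤ (2^(Nat.log 2 N+1))^2 := Nat.pow_le_pow_left h2 2
      _ = 2^(2 * Nat.log 2 N + 2) := by rw [← pow_mul]; ring_nf
  calc Nat.log 2 m ≤ Nat.log 2 (2^(2 * Nat.log 2 N + 2)) := Nat.log_mono_right this
    _ = _ := Nat.log_pow (by norm_num) _

theorem inv_cost [Fintype M] {h x y : M} (A : Set M) (h1 : 1 ∈ A) (D : ℕ) (hx : Cst A D x)
    (a : h * x = x) (b : h * y = y) (b' : y * h = y) (c : x * y = h) (d : y * x = h) :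
    Cst A (D + 2 * (2 * Nat.log 2 (Fintype.card M) + 2)) y := by
  obtain ⟨m, m1, m2, m3⟩ := exists_idem_pow x
  have p : ∀ i, x^(i+1) * y^(i+1) = h := by
    intro i
    induction i with
    | zero => simpa using c
    | succ i ih =>
      rw [pow_succ' x, pow_succ y]
      calc x * x^(i+1) * (y^(i+1) * y) = x * (x^(i+1) * y^(i+1)) * y := by simp only [mul_assoc]
        _ = h := by rw [ih, mul_assoc, b, c]
  obtain ⟨j, rfl⟩ : ∃ j, m = j + 1 := ⟨m-1, by omega⟩
  have e : x^(j+1) = h := by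
    have q : x^(j+1) * h = x^(j+1) := by
      rw [pow_succ, mul_assoc, ← d, ← mul_assoc x, c, a]
    calc x^(j+1) = x^(j+1) * (x^(j+1) * y^(j+1)) := by rw [p, q]
      _ = h := by rw [← mul_assoc, m3, p]
  rcases Nat.eq_zero_or_pos j with hj | hj
  · subst hj
    have : y = x := by rw [← b, ← e, zero_add, pow_one, c, ← e, zero_add, pow_one]
    rw [this]; exact hx.le (by omega)
  · obtain ⟨i, rfl⟩ : ∃ i, j = i + 1 := ⟨j-1, by omega⟩
    have : y = x^(i+1) := by
      calc y = y * x^(i+1+1) := by rw [e, b']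
        _ = x^(i+1) := by rw [pow_succ', ← mul_assoc, d, pow_succ', ← mul_assoc, a]
    rw [this]
    refine (hx.pow h1 _).le ?_
    have := log_idem (Fintype.card M) (i+1) (by omega)
    omega

/-- every long list of non-identity elements has an idempotent factor after rewriting -/
def LongL (M : Type*) [Monoid M] (n : ℕ) : Prop :=
  ∀ l : List M, (∀ x ∈ l, x ≠ 1) → n ≤ l.length → ∃ la le lb : List M,
    l.prod = la.prod * le.prod * lb.prod ∧ (∀ x ∈ la ++ le ++ lb, x ∈ l) ∧ le ≠ [] ∧
    le.prod * le.prod = le.prod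

theorem Good.letters (H : Good M k) {n : ℕ} (LL : LongL M n) {h : M} (h1 : h ≠ 1)
    (hh : h * h = h) (P : M → Prop) (hP : ∀ x, P x → St h x ∧ x ≠ 1) (T : Set M)
    (hT : ∀ l : List M, (∀ x ∈ l, P x) → l.length ≤ n + 1 →
      h * l.prod * h ∈ T ∧ iv k (h * l.prod * h) ∈ T) :
    ∀ l : List M, (∀ x ∈ l, P x) → n ≤ l.length → h * l.prod * h ∈ Subsemigroup.closure T := by
  intro l
  induction l using List.reverseRecOn with
  | nil => intro _ _; exact Subsemigroup.subset_closure (hT [] (by simp) (by simp)).1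
  | append_singleton l s ih =>
    intro hl hn
    rw [List.length_append, List.length_singleton] at hn
    by_cases hc : l.length ≤ n
    · exact Subsemigroup.subset_closure (hT _ hl (by simpa using hc)).1
    · push Not at hc
      have hl' : ∀ x ∈ l, P x := fun x hx => hl x (by simp [hx])
      have hs : P s := hl s (by simp)
      have i := ih hl' (by omega)
      set yl := l.take (l.length - n)
      set vl := l.drop (l.length - n)
      have hyv : l = yl ++ vl := (List.take_append_drop _ _).symm
      have hv : vl.length = n := by simp only [vl, List.length_drop]; omega
      have hPv : ∀ x ∈ vl, P x := fun x hx => hl' x (by rw [hyv]; simp [hx])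
      have hPy : ∀ x ∈ yl, P x := fun x hx => hl' x (by rw [hyv]; simp [hx])
      obtain ⟨la, le, lb, e1, e2, e3, e4⟩ := LL vl (fun x hx => (hP x (hPv x hx)).2) (by omega)
      have sS : ∀ x ∈ la ++ le ++ lb, St h x := fun x hx => (hP x (hPv x (e2 x hx))).1
      obtain ⟨z, hz⟩ := List.exists_mem_of_ne_nil _ e3
      have le1 : le.prod ≠ 1 := H.prod_ne_one le z hz
        (hP z (hPv z (e2 z (by simp [hz])))).2
      have key := H.long_right h1 hh le1 e4
        (H.st_list h1 hh la fun x hx => sS x (by simp [hx]))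
        (H.st_list h1 hh le fun x hx => sS x (by simp [hx]))
        (H.st_list h1 hh lb fun x hx => sS x (by simp [hx]))
        (H.st_list h1 hh yl fun x hx => (hP x (hPy x hx)).1)
      rw [← e1] at key
      have t1 := Subsemigroup.subset_closure (hT vl hPv (by omega)).2
      have t2 := Subsemigroup.subset_closure (hT (vl ++ [s]) (by
        intro x hx
        rcases List.mem_append.1 hx with hx | hx
        · exact hPv x hx
        · simp at hx; rwa [hx]) (by simp [hv])).1
      have := mul_mem (mul_mem i t1) t2
      convert this using 1
      rw [hyv]
      simp only [List.prod_append, List.prod_singleton]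
      calc h * (yl.prod * vl.prod * s) * h = (h * yl.prod * vl.prod) * (s * h) := by
            simp only [mul_assoc]
        _ = (h * yl.prod * vl.prod * h * gam k h vl.prod) * (s * h) := by rw [← key]
        _ = _ := by
            unfold gam; simp only [mul_assoc]

theorem iv_isU (H : Good M k) {h s : M} (h1 : h ≠ 1) (hh : h * h = h) (hs : St h s) :
    IsU h (h*s*h) ∧ IsU h (iv k (h*s*h)) := by
  obtain ⟨a, b, c, d⟩ := H.iv_spec h1 hh hs
  have e1 : h * (h*s*h) = h*s*h := by simp only [← mul_assoc]; rw [hh]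
  have e2 : (h*s*h) * h = h*s*h := by rw [mul_assoc, hh]
  exact ⟨⟨e1, e2, _, c, d, a, b⟩, ⟨c, d, _, e1, e2, b, a⟩⟩

theorem prod_flatten_replicate (l : List M) (m : ℕ) :
    (List.replicate m l).flatten.prod = l.prod ^ m := by
  induction m with
  | zero => simp
  | succ m ih => rw [List.replicate_succ, List.flatten_cons, List.prod_append, ih, pow_succ']

theorem length_flatten_replicate {α : Type*} (l : List α) (hl : l ≠ []) (m : ℕ) :
    m ≤ (List.replicate m l).flatten.length := by
  have : 1 ≤ l.length := List.length_pos_iff.2 hl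
  simp only [List.length_flatten, List.map_replicate, List.sum_replicate, smul_eq_mul]
  exact Nat.le_mul_of_pos_right m this

theorem mem_flatten_replicate {α : Type*} {l : List α} {m : ℕ} {x : α}
    (h : x ∈ (List.replicate m l).flatten) : x ∈ l := by
  obtain ⟨l', h1, h2⟩ := List.mem_flatten.1 h
  rwa [(List.mem_replicate.1 h1).2] at h2

theorem idem_pow {e : M} (ee : e * e = e) (m : ℕ) : e^(m+1) = e := by
  induction m with
  | zero => simp
  | succ m ih => rw [pow_succ, ih, ee]

theorem Good.compress [Fintype M] (H : Good M k) {n : ℕ} (LL : LongL M n) (Sig : Set M)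
    (hSig : 1 ∉ Sig) (l : List M) (hl : ∀ x ∈ l, x ∈ Sig) :
    Cst (insert 1 Sig) ((Nat.log 2 (Fintype.card M) + 1) *
      (8 * Nat.log 2 (Fintype.card M) + 3 * n + 20)) l.prod := by
  set L := Nat.log 2 (Fintype.card M) with hL
  have small : ∀ l : List M, (∀ x ∈ l, x ∈ Sig) → Cst (insert 1 Sig) l.length l.prod := by
    intro l hl
    simpa using Cst.list_prod (r := 0) (A := insert 1 Sig) (by simp) l
      (fun x hx => Cst.of_mem 0 (by simp [hl x hx]))
  by_cases hlen : l.length < 2 * n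
  · exact (small l hl).le (by nlinarith)
  push Not at hlen
  set p := l.take n with hp
  set x := (l.drop n).take (l.length - 2 * n) with hx
  set q := (l.drop n).drop (l.length - 2 * n) with hq
  have hsplit : l = p ++ (x ++ q) := by
    rw [hx, hq, List.take_append_drop, hp, List.take_append_drop]
  have lp : p.length = n := by rw [hp, List.length_take]; omega
  have lq : q.length = n := by rw [hq, List.length_drop, List.length_drop]; omega
  have hpS : ∀ y ∈ p, y ∈ Sig := fun y hy => hl y (by rw [hsplit]; simp [hy])
  have hxS : ∀ y ∈ x, y ∈ Sig := fun y hy => hl y (by rw [hsplit]; simp [hy])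
  have hqS : ∀ y ∈ q, y ∈ Sig := fun y hy => hl y (by rw [hsplit]; simp [hy])
  have S1 : ∀ y ∈ Sig, y ≠ 1 := fun y hy h => hSig (h ▸ hy)
  obtain ⟨pa, pe, pb, p1, p2, p3, p4⟩ := LL p (fun y hy => S1 y (hpS y hy)) lp.ge
  obtain ⟨qa, qe, qb, q1, q2, q3, q4⟩ := LL q (fun y hy => S1 y (hqS y hy)) lq.ge
  set Cl := pe ++ pb ++ x ++ qa ++ qe with hCl
  have ClS : ∀ y ∈ Cl, y ∈ Sig := by
    intro y hy
    simp only [hCl, List.mem_append] at hy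
    rcases hy with (((hy | hy) | hy) | hy) | hy
    · exact hpS _ (p2 y (by simp [hy]))
    · exact hpS _ (p2 y (by simp [hy]))
    · exact hxS _ hy
    · exact hqS _ (q2 y (by simp [hy]))
    · exact hqS _ (q2 y (by simp [hy]))
  obtain ⟨D, D1, D2, m, m1, m2, m3, m4, m5⟩ := H.descent Cl (by simp [hCl, p3])
    (fun y hy => S1 y (ClS y hy))
  set h := D.toList.prod ^ m with hh
  have h1 : h ≠ 1 := H.pow_ne_one m3 m1
  have hDL : D.card ≤ L := (Nat.le_log_iff_pow_le (by norm_num) (by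
    have : 0 < Fintype.card M := Fintype.card_pos
    omega)).2 D2
  have costh : Cst (insert 1 Sig) (5 * L + 4) h := by
    have a := small D.toList (fun y hy => ClS y (D1 y (by simpa using hy)))
    refine (a.pow (by simp) m).le ?_
    have := log_idem _ _ m2
    rw [Finset.length_toList]
    omega
  -- the two lists
  set V := (List.replicate (n+1) pe).flatten ++ pb with hV
  set V' := qa ++ (List.replicate (n+1) qe).flatten with hV'
  set v := V.drop (V.length - n) with hv
  set u := V.take (V.length - n) with hu
  set v' := V'.take n with hv'
  set u' := V'.drop n with hu'
  have VL : n ≤ V.length := by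
    have := length_flatten_replicate pe p3 (n+1)
    rw [hV, List.length_append]; omega
  have VL' : n ≤ V'.length := by
    have := length_flatten_replicate qe q3 (n+1)
    rw [hV', List.length_append]; omega
  have lv : v.length = n := by rw [hv, List.length_drop]; omega
  have lv' : v'.length = n := by rw [hv', List.length_take]; omega
  have VC : ∀ y ∈ V, y ∈ Cl := by
    intro y hy
    rcases List.mem_append.1 hy with hy | hy
    · have := mem_flatten_replicate hy; simp [hCl, this]
    · simp [hCl, hy]
  have VC' : ∀ y ∈ V', y ∈ Cl := by
    intro y hy
    rcases List.mem_append.1 hy with hy | hy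
    · simp [hCl, hy]
    · have := mem_flatten_replicate hy; simp [hCl, this]
  have vC : ∀ y ∈ v, y ∈ Cl := fun y hy => VC y (List.mem_of_mem_drop hy)
  have uC : ∀ y ∈ u, y ∈ Cl := fun y hy => VC y (List.mem_of_mem_take hy)
  have vC' : ∀ y ∈ v', y ∈ Cl := fun y hy => VC' y (List.mem_of_mem_take hy)
  have uC' : ∀ y ∈ u', y ∈ Cl := fun y hy => VC' y (List.mem_of_mem_drop hy)
  have Cl1 : ∀ y ∈ Cl, y ≠ 1 := fun y hy => S1 y (ClS y hy)
  obtain ⟨va, ve, vb, w1, w2, w3, w4⟩ := LL v (fun y hy => Cl1 y (vC y hy)) lv.ge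
  obtain ⟨wa, we, wb, z1, z2, z3, z4⟩ := LL v' (fun y hy => Cl1 y (vC' y hy)) lv'.ge
  have ne1 : ∀ l : List M, l ≠ [] → (∀ y ∈ l, y ∈ Cl) → l.prod ≠ 1 := by
    intro l hl hl'
    obtain ⟨z, hz⟩ := List.exists_mem_of_ne_nil _ hl
    exact H.prod_ne_one l z hz (Cl1 z (hl' z hz))
  have stl : ∀ l : List M, (∀ y ∈ l, y ∈ Cl) → St h l.prod := fun l hl =>
    H.st_list h1 m4 l fun y hy => m5 y (hl y hy)
  have i_pe : ∀ y ∈ pe, y ∈ Cl := fun y hy => by simp [hCl, hy]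
  have i_pb : ∀ y ∈ pb, y ∈ Cl := fun y hy => by simp [hCl, hy]
  have i_x : ∀ y ∈ x, y ∈ Cl := fun y hy => by simp [hCl, hy]
  have i_qa : ∀ y ∈ qa, y ∈ Cl := fun y hy => by simp [hCl, hy]
  have i_qe : ∀ y ∈ qe, y ∈ Cl := fun y hy => by simp [hCl, hy]
  have core := H.core (h := h) (e := pe.prod) (e' := qe.prod) (b := pb.prod) (x := x.prod)
    (a' := qa.prod) (u := u.prod) (v := v.prod) (u' := u'.prod) (v' := v'.prod)
    h1 m4 (ne1 _ p3 i_pe) p4 (ne1 _ q3 i_qe) q4 (stl _ i_pe) (stl _ i_qe) (stl _ i_pb) (stl _ i_x)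
    (stl _ i_qa) (stl _ uC) (stl _ uC') w1
    (stl _ fun y hy => vC y (w2 y (by simp [hy]))) (stl _ fun y hy => vC y (w2 y (by simp [hy])))
    (stl _ fun y hy => vC y (w2 y (by simp [hy])))
    (ne1 _ w3 fun y hy => vC y (w2 y (by simp [hy]))) w4 z1
    (stl _ fun y hy => vC' y (z2 y (by simp [hy]))) (stl _ fun y hy => vC' y (z2 y (by simp [hy])))
    (stl _ fun y hy => vC' y (z2 y (by simp [hy])))
    (ne1 _ z3 fun y hy => vC' y (z2 y (by simp [hy]))) z4
    (by
      rw [← List.prod_append (l₁ := u), hu, hv, List.take_append_drop, hV, List.prod_append,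
        prod_flatten_replicate, idem_pow p4])
    (by
      rw [← List.prod_append (l₁ := v'), hu', hv', List.take_append_drop, hV', List.prod_append,
        prod_flatten_replicate, idem_pow q4])
    (by
      intro f f1 ff hf
      have e : pe.prod * pb.prod * x.prod * qa.prod * qe.prod = Cl.prod := by
        rw [hCl]; simp only [List.prod_append]
      rw [e] at hf
      have := H.st_of_list f1 ff _ hf
      refine H.st_pow' f1 ff (H.st_list f1 ff _ fun y hy => this y (D1 y (by simpa using hy))) m)
  -- cost of the middle part
  set A := insert h (insert 1 Sig) with hA
  have hA1 : (1 : M) ∈ A := by simp [hA]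
  have hAh : h ∈ A := by simp [hA]
  set T : Set M := {g | Cst A (n + 4 * L + 7) g ∧ IsU h g} with hT
  have inT : ∀ l : List M, (∀ y ∈ l, y ∈ Cl) → l.length ≤ n + 1 →
      h * l.prod * h ∈ T ∧ iv k (h * l.prod * h) ∈ T := by
    intro l hl hn
    have sl := stl l hl
    obtain ⟨U1, U2⟩ := iv_isU H h1 m4 sl
    have c1 : Cst A (n + 3) (h * l.prod * h) := by
      have c0 : Cst A l.length l.prod := (small l fun y hy => ClS y (hl y hy)).mono (by simp [hA])
      exact (((Cst.of_mem 0 hAh).mul c0).mul (Cst.of_mem 0 hAh)).le (by omega)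
    refine ⟨⟨c1.le (by omega), U1⟩, ?_, U2⟩
    obtain ⟨a, b, c, d⟩ := H.iv_spec h1 m4 sl
    exact (inv_cost A hA1 _ c1 U1.1 c d a b).le (by omega)
  have midT := H.letters LL h1 m4 (fun y => y ∈ Cl) (fun y hy => ⟨m5 y hy, Cl1 y hy⟩) T inT
    (v ++ x ++ v') (by
      intro y hy
      simp only [List.mem_append] at hy
      rcases hy with (hy | hy) | hy
      · exact vC y hy
      · exact i_x y hy
      · exact vC' y hy) (by simp only [List.length_append]; omega)
  have t1 := Subsemigroup.subset_closure (inT v vC (by omega)).2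
  have t2 := Subsemigroup.subset_closure (inT v' vC' (by omega)).2
  have yT := mul_mem (mul_mem t1 midT) t2
  have yeq : iv k (h * v.prod * h) * (h * (v ++ x ++ v').prod * h) * iv k (h * v'.prod * h) =
      gam k h v.prod * x.prod * gam' k h v'.prod := by
    unfold gam gam'
    simp only [List.prod_append, mul_assoc]
  rw [yeq] at yT
  have cy := bsz_corner m4 A hA1 hAh _ T (fun y hy => hy) _ yT
  rw [← hL] at cy
  have fin : l.prod = p.prod * (gam k h v.prod * x.prod * gam' k h v'.prod) * q.prod := by
    rw [hsplit, List.prod_append, List.prod_append, p1, q1]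
    calc _ = pa.prod * (pe.prod * pb.prod * x.prod * qa.prod * qe.prod) * qb.prod := by
          simp only [mul_assoc]
      _ = pa.prod * (pe.prod * pb.prod * (gam k h v.prod * x.prod * gam' k h v'.prod) *
            qa.prod * qe.prod) * qb.prod := by rw [← core]
      _ = _ := by simp only [mul_assoc]
  have cp : Cst A n p.prod := lp ▸ (small p hpS).mono (by simp [hA])
  have cq : Cst A n q.prod := lq ▸ (small q hqS).mono (by simp [hA])
  rw [fin]
  refine (costh.bind ((cp.mul cy).mul cq)).le ?_
  nlinarith

end corner

section identity
variable {M : Type*} [Monoid M]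

/-- the identity `x₀ ⋯ x_{ℓ-1} = w` for non-identity elements of `M` -/
def Idt (M : Type*) [Monoid M] (l : ℕ) (w : List (Fin l)) : Prop :=
  ∀ x : Fin l → M, (∀ j, x j ≠ 1) → ((List.finRange l).map x).prod = (w.map x).prod

theorem count_prod {ι : Type*} [DecidableEq ι] (i : ι) (x : ι → M) (z e : M) (hz : x i = z)
    (he : ∀ j, j ≠ i → x j = e) (ze : z * e = z) (w : List ι) :
    ∀ u : M, u * e = u → u * (w.map x).prod = u * z ^ (w.count i) := by
  induction w with
  | nil => intro u _; simp
  | cons j w ih =>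
    intro u hu
    rw [List.map_cons, List.prod_cons, ← mul_assoc]
    by_cases hj : j = i
    · subst hj
      rw [hz, List.count_cons_self, ih (u*z) (by rw [mul_assoc, ze]), pow_succ', mul_assoc]
    · rw [he j hj, hu, ih u hu, List.count_cons_of_ne hj]

theorem absorb_left {ι : Type*} (x : ι → M) (e : M) (w : List ι) (he : ∀ j ∈ w, x j = e)
    (ee : e * e = e) : e * (w.map x).prod = e := by
  induction w with
  | nil => simp
  | cons j w ih =>
    rw [List.map_cons, List.prod_cons, ← mul_assoc, he j (by simp), ee]
    exact ih fun j hj => he j (by simp [hj])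

theorem absorb_right {ι : Type*} (x : ι → M) (e : M) (w : List ι) (he : ∀ j ∈ w, x j = e)
    (ee : e * e = e) : (w.map x).prod * e = e := by
  induction w with
  | nil => simp
  | cons j w ih =>
    rw [List.map_cons, List.prod_cons, mul_assoc, ih fun j hj => he j (by simp [hj]),
      he j (by simp), ee]

theorem ha_of_idt [Fintype M] (nu : ∀ x y : M, x * y = 1 → x = 1 ∧ y = 1) {l : ℕ}
    (w : List (Fin l)) (hw2 : ¬ w.Nodup) (hid : Idt M l w) :
    ∃ k, 3 ≤ k ∧ ∀ e f a : M, e ≠ 1 → f ≠ 1 → e * e = e → f * f = f → (e*a*f)^k = e*a*f := by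
  rw [List.nodup_iff_count_le_one] at hw2
  push Not at hw2
  obtain ⟨i, hi⟩ := hw2
  have him : i ∈ w := List.count_pos_iff.1 (by omega)
  obtain ⟨w1, w2, hw, hiw1⟩ := List.eq_append_cons_of_mem him
  have hiw2 : i ∈ w2 := by
    rw [← List.count_pos_iff]
    rw [hw, List.count_append, List.count_cons_self, List.count_eq_zero_of_not_mem hiw1] at hi
    omega
  set κ := w.count i with hκ
  have base : ∀ e a : M, e ≠ 1 → e * e = e → (e*a*e)^(2*κ-1) = e*a*e := by
    intro e a e1 ee
    set z := e*a*e with hz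
    have ez : e * z = z := by rw [hz]; simp only [← mul_assoc]; rw [ee]
    have ze : z * e = z := by rw [hz, mul_assoc, ee]
    have z1 : z ≠ 1 := fun h => e1 (nu _ _ h).2
    have q := hid (fun j => if j = i then z else e) (by intro j; split_ifs <;> assumption)
    have c1 := count_prod i (fun j => if j = i then z else e) z e (by simp) (by
      intro j hj; simp [hj]) ze (List.finRange l) e ee
    have c2 := count_prod i (fun j => if j = i then z else e) z e (by simp) (by
      intro j hj; simp [hj]) ze w e ee
    rw [q, c2, List.count_eq_one_of_mem (List.nodup_finRange l) (List.mem_finRange i), pow_one, ez,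
      ← hκ] at c1
    have c3 : z^κ = z := by
      obtain ⟨j, hj⟩ : ∃ j, κ = j + 1 := ⟨κ-1, by omega⟩
      rw [hj, pow_succ', ← mul_assoc, ez, ← pow_succ', ← hj] at c1
      exact c1
    rw [show 2 * κ - 1 = κ + (κ - 1) by omega, pow_add, c3, ← pow_succ',
      Nat.sub_add_cancel (by omega), c3]
  refine ⟨2*κ-1, by omega, ?_⟩
  intro e f a e1 f1 ee ff
  set c := e*a*f with hc
  have ec : e * c = c := by rw [hc]; simp only [← mul_assoc]; rw [ee]
  have cf : c * f = c := by rw [hc, mul_assoc, ff]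
  have c1 : c ≠ 1 := fun h => f1 (nu _ _ h).2
  set x : Fin l → M := fun j => if j < i then e else if j = i then c else f with hx
  have xi : x i = c := by simp [hx]
  have xlt : ∀ j, j < i → x j = e := fun j hj => by simp [hx, hj]
  have xgt : ∀ j, i < j → x j = f := fun j hj => by
    simp [hx, not_lt.2 hj.le, hj.ne']
  have q := hid x (by
    intro j
    rcases lt_trichotomy j i with h | h | h
    · rwa [xlt j h]
    · rwa [h, xi]
    · rwa [xgt j h])
  have fr : List.finRange l = (List.finRange l).take i ++ i :: (List.finRange l).drop (i+1) := by
    conv_lhs => rw [← List.take_append_drop i (List.finRange l)]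
    congr 1
    rw [List.drop_eq_getElem_cons (by simp)]
    simp
  have lhs : e * ((List.finRange l).map x).prod * f = c := by
    rw [fr, List.map_append, List.prod_append, List.map_cons, List.prod_cons, ← mul_assoc,
      ← mul_assoc, absorb_left x e _ _ ee, xi, mul_assoc, absorb_right x f _ _ ff, ec, cf]
    · intro j hj
      obtain ⟨t, ht, rfl⟩ := List.mem_iff_getElem.1 hj
      apply xgt
      simp [Fin.lt_def]
      omega
    · intro j hj
      obtain ⟨t, ht, rfl⟩ := List.mem_iff_getElem.1 hj
      apply xlt
      simp at ht
      simp [Fin.lt_def]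
      omega
  set α := e * (w1.map x).prod with hα
  set β := (w2.map x).prod * f with hβ
  have cab : c = α * c * β := by
    rw [q, hw, List.map_append, List.prod_append, List.map_cons, List.prod_cons, xi] at lhs
    conv_lhs => rw [← lhs]
    simp only [hα, hβ, mul_assoc]
  have cabm : ∀ m, c = α^m * c * β^m := by
    intro m
    induction m with
    | zero => simp
    | succ m ih =>
      rw [pow_succ, pow_succ']
      calc c = α^m * c * β^m := ih
        _ = α^m * (α * c * β) * β^m := by rw [← cab]
        _ = _ := by simp only [mul_assoc]
  obtain ⟨m, m1, -, m3⟩ := exists_idem_pow β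
  have cb : c * β^m = c := by
    conv_rhs => rw [cabm m, ← m3]
    conv_lhs => rw [cabm m]
    simp only [mul_assoc]
  have step : ∀ v : List (Fin l), i ∈ v → ∃ y, c * (v.map x).prod = c * e * y := by
    intro v
    induction v with
    | nil => intro h; simp at h
    | cons j v ih =>
      intro h
      rw [List.map_cons, List.prod_cons]
      rcases lt_trichotomy j i with hj | hj | hj
      · exact ⟨(v.map x).prod, by rw [xlt j hj]; simp only [mul_assoc]⟩
      · exact ⟨c * (v.map x).prod, by
          rw [hj, xi, mul_assoc c e, ← mul_assoc e, ec]⟩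
      · rw [xgt j hj, ← mul_assoc, cf]
        exact ih (by simpa [hj.ne] using h)
  obtain ⟨y, hy⟩ := step w2 hiw2
  have cz : c = (c * e) * (y * f * β^(m-1)) := by
    conv_lhs => rw [← cb, ← Nat.sub_add_cancel m1, pow_succ', hβ]
    calc c * ((w2.map x).prod * f * ((w2.map x).prod * f)^(m-1)) =
        (c * (w2.map x).prod) * f * ((w2.map x).prod * f)^(m-1) := by simp only [mul_assoc]
      _ = _ := by rw [hy]; simp only [hβ, mul_assoc]
  have zk := base e (a*f) e1 ee
  rw [show e * (a*f) * e = c * e by rw [hc]; simp only [mul_assoc]] at zk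
  set k := 2*κ-1 with hk
  obtain ⟨j, hj⟩ : ∃ j, k = j + 1 := ⟨k-1, by omega⟩
  rw [hj] at zk ⊢
  have zc : ∀ t, (c*e)^t * c = c^(t+1) := by
    intro t
    induction t with
    | zero => simp
    | succ t ih => rw [pow_succ', mul_assoc, ih, pow_succ' c t, mul_assoc c e, ← mul_assoc e, ec,
        ← pow_succ', ← pow_succ']
  rw [← zc]
  calc (c*e)^j * c = (c*e)^j * ((c * e) * (y * f * β^(m-1))) := by rw [← cz]
    _ = (c*e)^(j+1) * (y * f * β^(m-1)) := by rw [pow_succ]; simp only [mul_assoc]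
    _ = c := by rw [zk, ← cz]

theorem longL_of_idt [Fintype M] {l n : ℕ} (hln : l ≤ n) (w : List (Fin l)) (hw1 : ∀ i, i ∈ w)
    (hw2 : ¬ w.Nodup) (hid : Idt M l w) : LongL M n := by
  classical
  have hwl : l < w.length := by
    have a : w.toFinset = Finset.univ := by ext i; simp [hw1 i]
    have b : w.toFinset.card = l := by rw [a]; simp
    have c := List.toFinset_card_le w
    rcases Nat.lt_or_ge l w.length with h | h
    · exact h
    · exact absurd (Multiset.toFinset_card_eq_card_iff_nodup.1
        (show (w : Multiset (Fin l)).toFinset.card = _ by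
          rw [List.toFinset_coe]; simp; omega)) (by simpa using hw2)
  intro L hL hn
  have long : ∀ N, ∃ L' : List M, N ≤ L'.length ∧ l ≤ L'.length ∧ L'.prod = L.prod ∧
      ∀ x ∈ L', x ∈ L := by
    intro N
    induction N with
    | zero => exact ⟨L, by omega, by omega, rfl, fun x h => h⟩
    | succ N ih =>
      obtain ⟨L', h1, h2, h3, h4⟩ := ih
      set x : Fin l → M := fun j => L'[j.1]'(by omega) with hx
      have hxm : ∀ j, x j ∈ L' := fun j => List.getElem_mem _
      have ht : L'.take l = (List.finRange l).map x := by
        apply List.ext_getElem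
        · simp [h2]
        · intro t h h'
          simp [hx]
      refine ⟨w.map x ++ L'.drop l, ?_, ?_, ?_, ?_⟩
      · simp only [List.length_append, List.length_map, List.length_drop]; omega
      · simp only [List.length_append, List.length_map, List.length_drop]; omega
      · rw [List.prod_append, ← hid x fun j => hL _ (h4 _ (hxm j)), ← ht, ← List.prod_append,
          List.take_append_drop, h3]
      · intro y hy
        rcases List.mem_append.1 hy with hy | hy
        · obtain ⟨j, -, rfl⟩ := List.mem_map.1 hy
          exact h4 _ (hxm j)
        · exact h4 _ (List.mem_of_mem_drop hy)
  obtain ⟨L', h1, -, h3, h4⟩ := long (Fintype.card M)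
  have : ¬ Function.Injective (fun i : Fin (Fintype.card M + 1) => (L'.take i).prod) := by
    intro h
    have := Fintype.card_le_of_injective _ h
    simp at this
  rw [Function.not_injective_iff] at this
  obtain ⟨i, j, hij, hne⟩ := this
  wlog hlt : i < j generalizing i j
  · exact this j i hij.symm hne.symm (lt_of_le_of_ne (not_lt.1 hlt) hne.symm)
  have hlt' : i.1 < j.1 := hlt
  have hj := j.2
  set v := (L'.take j).drop i with hv
  have hP : (L'.take i).prod = (L'.take i).prod * v.prod := by
    have : L'.take j = L'.take i ++ v := by
      conv_lhs => rw [← List.take_append_drop i.1 (L'.take j.1), List.take_take, min_eq_left hlt'.le]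
    conv_lhs => rw [hij, this]
    rw [List.prod_append]
  obtain ⟨m, m1, -, m3⟩ := exists_idem_pow v.prod
  have hPm : ∀ t, (L'.take i).prod = (L'.take i).prod * v.prod^t := by
    intro t
    induction t with
    | zero => simp
    | succ t ih => rw [pow_succ', ← mul_assoc, ← hP, ← ih]
  refine ⟨L'.take i, (List.replicate m v).flatten, L'.drop i, ?_, ?_, ?_, ?_⟩
  · rw [prod_flatten_replicate, ← hPm, ← List.prod_append, List.take_append_drop, h3]
  · intro x hx
    apply h4
    simp only [List.mem_append] at hx
    rcases hx with (hx | hx) | hx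
    · exact List.mem_of_mem_take hx
    · exact List.mem_of_mem_take (List.mem_of_mem_drop (mem_flatten_replicate hx))
    · exact List.mem_of_mem_drop hx
  · have vl : v ≠ [] := by
      rw [← List.length_pos_iff, hv, List.length_drop, List.length_take]; omega
    have := length_flatten_replicate v vl m
    rw [← List.length_pos_iff]; omega
  · rw [prod_flatten_replicate]; exact m3

end identity

section perm
variable {M : Type*} [Monoid M]

theorem split_at {α : Type*} [DecidableEq α] (w : List α) (hw : w.Nodup) (i : α) (hi : i ∈ w) :
    w = w.take (w.idxOf i) ++ i :: w.drop (w.idxOf i + 1) ∧ i ∉ w.take (w.idxOf i) ∧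
      i ∉ w.drop (w.idxOf i + 1) := by
  have hlt : w.idxOf i < w.length := List.idxOf_lt_length_iff.2 hi
  have e : w = w.take (w.idxOf i) ++ i :: w.drop (w.idxOf i + 1) := by
    conv_lhs => rw [← List.take_append_drop (w.idxOf i) w, List.drop_eq_getElem_cons hlt]
    simp
  refine ⟨e, ?_, ?_⟩
  · intro h
    rw [e, List.nodup_append] at hw
    exact hw.2.2 i h i (by simp) rfl
  · intro h
    rw [e, List.nodup_append] at hw
    exact (List.nodup_cons.1 hw.2.1).1 h

theorem map_update_of_notMem {M α : Type*} [DecidableEq α] (w : List α) (i : α) (hi : i ∉ w)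
    (x : α → M) (z : M) : w.map (Function.update x i z) = w.map x := by
  apply List.map_congr_left
  intro j hj
  rw [Function.update_of_ne]
  rintro rfl
  exact hi hj

theorem ins_after {α : Type*} [DecidableEq α] (w : List α) (hw : w.Nodup) (i : α) (hi : i ∈ w)
    (x : α → M) (y : M) : (w.map (Function.update x i (x i * y))).prod =
      ((w.map x).take (w.idxOf i + 1)).prod * y * ((w.map x).drop (w.idxOf i + 1)).prod := by
  obtain ⟨e, h1, h2⟩ := split_at w hw i hi
  have hlt : w.idxOf i < w.length := List.idxOf_lt_length_iff.2 hi
  conv_lhs => rw [e]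
  rw [List.map_append, List.map_cons, map_update_of_notMem _ _ h1, map_update_of_notMem _ _ h2,
    Function.update_self, ← List.map_take, ← List.map_drop, List.prod_append, List.prod_cons]
  rw [List.take_add_one, List.getElem?_eq_getElem hlt, List.map_append, List.prod_append]
  simp [mul_assoc]

theorem ins_before {α : Type*} [DecidableEq α] (w : List α) (hw : w.Nodup) (i : α) (hi : i ∈ w)
    (x : α → M) (y : M) : (w.map (Function.update x i (y * x i))).prod =
      ((w.map x).take (w.idxOf i)).prod * y * ((w.map x).drop (w.idxOf i)).prod := by
  obtain ⟨e, h1, h2⟩ := split_at w hw i hi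
  have hlt : w.idxOf i < w.length := List.idxOf_lt_length_iff.2 hi
  conv_lhs => rw [e]
  rw [List.map_append, List.map_cons, map_update_of_notMem _ _ h1, map_update_of_notMem _ _ h2,
    Function.update_self, ← List.map_take, ← List.map_drop, List.prod_append, List.prod_cons]
  rw [List.drop_eq_getElem_cons hlt, List.map_cons, List.prod_cons]
  simp [mul_assoc]

theorem gap_of_idt (nu : ∀ x y : M, x * y = 1 → x = 1 ∧ y = 1) {l : ℕ}
    (w : List (Fin l)) (hw1 : ∀ i, i ∈ w) (hw2 : w.Nodup) (hw3 : w ≠ List.finRange l)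
    (hid : Idt M l w) :
    ∃ a b, a < b ∧ b ≤ l ∧ ∀ (P : List M) (y : M), (∀ x ∈ P, x ≠ 1) → y ≠ 1 → P.length = l →
      (P.take a).prod * y * (P.drop a).prod = (P.take b).prod * y * (P.drop b).prod := by
  have hlen : w.length = l := by
    have a : w.toFinset = Finset.univ := by ext i; simp [hw1 i]
    rw [← List.toFinset_card_of_nodup hw2, a]; simp
  have plt : ∀ i, w.idxOf i < l := fun i => by
    have := List.idxOf_lt_length_iff.2 (hw1 i); omega
  have ex : ∃ (i : ℕ) (h : i + 1 < l), w.idxOf (⟨i, by omega⟩ : Fin l) + 1 ≠ w.idxOf (⟨i+1, h⟩ : Fin l) := by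
    by_contra hcon
    push Not at hcon
    apply hw3
    rcases Nat.eq_zero_or_pos l with h0 | h0
    · subst h0
      simp at hlen
      simp [hlen]
    have lin : ∀ (i : ℕ) (h : i < l), w.idxOf (⟨i, h⟩ : Fin l) = w.idxOf (⟨0, h0⟩ : Fin l) + i := by
      intro i
      induction i with
      | zero => intro h; rfl
      | succ i ih =>
        intro h
        rw [← hcon i h, ih (by omega)]; omega
    have h00 : w.idxOf (⟨0, h0⟩ : Fin l) = 0 := by
      have := lin (l-1) (by omega)
      have := plt ⟨l-1, by omega⟩
      omega
    apply List.ext_getElem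
    · simp [hlen]
    · intro t h1 h2
      have ht : t < l := by omega
      have := lin t ht
      rw [h00, zero_add] at this
      have g : w[w.idxOf (⟨t, ht⟩ : Fin l)]'(by rw [this]; exact h1) = ⟨t, ht⟩ :=
        List.getElem_idxOf _
      simp only [this] at g
      rw [g]; simp
  obtain ⟨i, hi, hne⟩ := ex
  set i0 : Fin l := ⟨i, by omega⟩ with hi0
  set i1 : Fin l := ⟨i+1, hi⟩ with hi1
  have main : ∀ (P : List M) (y : M), (∀ x ∈ P, x ≠ 1) → y ≠ 1 → P.length = l →
      (P.take (w.idxOf i0 + 1)).prod * y * (P.drop (w.idxOf i0 + 1)).prod =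
      (P.take (w.idxOf i1)).prod * y * (P.drop (w.idxOf i1)).prod := by
    intro P y hP hy hPl
    set x : Fin l → M := fun j => P[w.idxOf j]'(by rw [hPl]; exact plt j) with hx
    have hx1 : ∀ j, x j ≠ 1 := fun j => hP _ (List.getElem_mem _)
    have hwx : w.map x = P := by
      apply List.ext_getElem
      · simp [hlen, hPl]
      · intro t h1 h2
        simp only [List.getElem_map, hx]
        congr 1
        exact List.Nodup.idxOf_getElem hw2 _ _
    have A := ins_after w hw2 i0 (hw1 _) x y
    have B := ins_before w hw2 i1 (hw1 _) x y
    have A' := ins_after (List.finRange l) (List.nodup_finRange l) i0 (by simp) x y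
    have B' := ins_before (List.finRange l) (List.nodup_finRange l) i1 (by simp) x y
    rw [← hid] at A
    · rw [← hid] at B
      · rw [hwx] at A B
        rw [← A, ← B, A', B']
        simp [hi0, hi1]
      · intro j
        by_cases hj : j = i1
        · subst hj; rw [Function.update_self]; exact fun h => hy (nu _ _ h).1
        · rw [Function.update_of_ne hj]; exact hx1 j
    · intro j
      by_cases hj : j = i0
      · subst hj; rw [Function.update_self]; exact fun h => hy (nu _ _ h).2
      · rw [Function.update_of_ne hj]; exact hx1 j
  rcases lt_or_gt_of_ne hne with h | h
  · exact ⟨_, _, h, (plt _).le, main⟩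
  · exact ⟨_, _, h, plt i0, fun P y a b c => (main P y a b c).symm⟩

theorem perm_of_idt (nu : ∀ x y : M, x * y = 1 → x = 1 ∧ y = 1) {l n : ℕ} (hln : l ≤ n)
    (w : List (Fin l)) (hw1 : ∀ i, i ∈ w) (hw2 : w.Nodup) (hw3 : w ≠ List.finRange l)
    (hid : Idt M l w) (m m' : List M) (hm : m.Perm m') : (∀ x ∈ m, x ≠ 1) → 
    ∀ A B : List M, (∀ x ∈ A, x ≠ 1) → (∀ x ∈ B, x ≠ 1) → n ≤ A.length → n ≤ B.length →
    A.prod * m.prod * B.prod = A.prod * m'.prod * B.prod := by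
  obtain ⟨a, b, hab, hbl, gap⟩ := gap_of_idt nu w hw1 hw2 hw3 hid
  have g1 : ∀ (A U R : List M) (y : M), (∀ x ∈ A, x ≠ 1) → (∀ x ∈ U, x ≠ 1) → (∀ x ∈ R, x ≠ 1) →
      y ≠ 1 → a ≤ A.length → U.length = b - a → l - b ≤ R.length →
      A.prod * y * (U.prod * R.prod) = A.prod * (U.prod * (y * R.prod)) := by
    intro A U R y hA hU hR hy lA lU lR
    set A0 := A.take (A.length - a) with hA0
    set A1 := A.drop (A.length - a) with hA1
    set R0 := R.take (l-b) with hR0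
    set R1 := R.drop (l-b) with hR1
    have eA : A = A0 ++ A1 := (List.take_append_drop _ _).symm
    have eR : R = R0 ++ R1 := (List.take_append_drop _ _).symm
    have lA1 : A1.length = a := by rw [hA1, List.length_drop]; omega
    have lR0 : R0.length = l - b := by rw [hR0, List.length_take]; omega
    have := gap (A1 ++ (U ++ R0)) y (by
      intro x hx
      simp only [List.mem_append] at hx
      rcases hx with hx | hx | hx
      · exact hA x (by rw [eA]; simp [hx])
      · exact hU x hx
      · exact hR x (by rw [eR]; simp [hx])) hy (by simp only [List.length_append]; omega)
    have t1 : (A1 ++ (U ++ R0)).take a = A1 := by rw [← lA1]; simp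
    have t2 : (A1 ++ (U ++ R0)).drop a = U ++ R0 := by rw [← lA1]; simp
    have hAU : (A1 ++ U).length = b := by simp only [List.length_append]; omega
    have t3 : (A1 ++ (U ++ R0)).take b = A1 ++ U := by
      rw [← hAU, ← List.append_assoc, List.take_left]
    have t4 : (A1 ++ (U ++ R0)).drop b = R0 := by
      rw [← hAU, ← List.append_assoc, List.drop_left]
    rw [t1, t2, t3, t4, List.prod_append, List.prod_append] at this
    rw [eA, eR, List.prod_append, List.prod_append]
    calc _ = A0.prod * (A1.prod * y * (U.prod * R0.prod)) * R1.prod := by simp only [mul_assoc]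
      _ = _ := by rw [this]; simp only [mul_assoc]
  have g2 : ∀ (A B : List M) (y z : M), (∀ x ∈ A, x ≠ 1) → (∀ x ∈ B, x ≠ 1) → y ≠ 1 → z ≠ 1 →
      l ≤ A.length → l ≤ B.length → A.prod * (y * (z * B.prod)) = A.prod * (z * (y * B.prod)) := by
    intro A B y z hA hB hy hz lA lB
    cases B with
    | nil => simp at lB; omega
    | cons b1 B =>
      rw [List.length_cons] at lB
      set U := B.take (b - a - 1) with hU
      set R := B.drop (b - a - 1) with hR
      have eB : B = U ++ R := (List.take_append_drop _ _).symm
      have lU : U.length = b - a - 1 := by rw [hU, List.length_take]; omega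
      have lR : l - b ≤ R.length := by rw [hR, List.length_drop]; omega
      have hb1 := hB b1 (by simp)
      have hUn : ∀ x ∈ U, x ≠ 1 := fun x hx => hB x (by rw [eB]; simp [hx])
      have hRn : ∀ x ∈ R, x ≠ 1 := fun x hx => hB x (by rw [eB]; simp [hx])
      have s1 := g1 A ((z*b1)::U) R y hA (by
        intro x hx
        rcases List.mem_cons.1 hx with rfl | hx
        · exact fun h => hz (nu _ _ h).1
        · exact hUn x hx) hRn hy (by omega) (by rw [List.length_cons, lU]; omega) lR
      have s2 := g1 (A ++ [z]) (b1::U) R y (by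
        intro x hx
        rcases List.mem_append.1 hx with hx | hx
        · exact hA x hx
        · simp at hx; rwa [hx]) (by
        intro x hx
        rcases List.mem_cons.1 hx with rfl | hx
        · exact hb1
        · exact hUn x hx) hRn hy (by simp only [List.length_append]; omega)
        (by rw [List.length_cons, lU]; omega) lR
      rw [eB, List.prod_cons, List.prod_append]
      simp only [List.prod_append, List.prod_cons, List.prod_nil, mul_one, mul_assoc] at s1 s2 ⊢
      rw [s1, ← s2]
  induction hm with
  | nil => intros; rfl
  | cons x _ ih =>
    intro hm A B hA hB lA lB
    have := ih (fun x hx => hm x (by simp [hx])) (A ++ [x]) B (by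
        intro z hx
        rcases List.mem_append.1 hx with hx | hx
        · exact hA z hx
        · simp at hx; rw [hx]; exact hm x (by simp)) hB
        (by simp only [List.length_append]; omega) lB
    simpa only [List.prod_append, List.prod_cons, List.prod_nil, mul_one, mul_assoc] using this
  | swap x y t =>
    intro hm A B hA hB lA lB
    have := g2 A (t ++ B) y x hA (by
      intro z hz
      rcases List.mem_append.1 hz with hz | hz
      · exact hm z (by simp [hz])
      · exact hB z hz) (hm y (by simp)) (hm x (by simp)) (by omega)
      (by simp only [List.length_append]; omega)
    simpa only [List.prod_append, List.prod_cons, mul_assoc] using this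
  | trans p q ih1 ih2 =>
    intro hm A B hA hB lA lB
    rw [ih1 hm A B hA hB lA lB, ih2 (fun x hx => hm x (p.mem_iff.2 hx)) A B hA hB lA lB]

theorem perm_rep {α : Type*} [DecidableEq α] (ds : List α) : ∀ l : List α, (∀ x ∈ l, x ∈ ds) →
    ∃ c : List (α × ℕ), c.length ≤ ds.length ∧ (∀ p ∈ c, p.1 ∈ ds) ∧
      l.Perm (c.flatMap fun p => List.replicate p.2 p.1) := by
  induction ds with
  | nil =>
    intro l hl
    have : l = [] := List.eq_nil_iff_forall_not_mem.2 fun x hx => by simpa using hl x hx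
    exact ⟨[], by simp, by simp, by simp [this]⟩
  | cons d ds ih =>
    intro l hl
    obtain ⟨c, c1, c2, c3⟩ := ih (l.filter (fun x => ¬ x = d)) (by
      intro x hx
      simp at hx
      have := hl x hx.1
      simpa [hx.2] using this)
    refine ⟨(d, l.count d) :: c, by simpa using c1, ?_, ?_⟩
    · intro p hp
      rcases List.mem_cons.1 hp with rfl | hp
      · simp
      · exact List.mem_cons_of_mem _ (c2 p hp)
    · rw [List.flatMap_cons]
      have h1 := List.filter_append_perm (fun x => decide (x = d)) l
      have h2 : l.filter (fun x => decide (x = d)) = List.replicate (l.count d) d := List.filter_eq d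
      rw [h2] at h1
      refine h1.symm.trans (List.Perm.append_left _ ?_)
      convert c3 using 3
      simp

theorem pow_red [Fintype M] (s : M) (m : ℕ) : ∃ m' ≤ Fintype.card M, s^m = s^m' := by
  induction m using Nat.strong_induction_on with
  | _ m ih =>
    by_cases hm : m ≤ Fintype.card M
    · exact ⟨m, hm, rfl⟩
    have : ¬ Function.Injective (fun i : Fin (Fintype.card M + 1) => s ^ i.1) := by
      intro h
      have := Fintype.card_le_of_injective _ h
      simp at this
    rw [Function.not_injective_iff] at this
    obtain ⟨i, j, hij, hne⟩ := this
    wlog hlt : i < j generalizing i j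
    · exact this j i hij.symm hne.symm (lt_of_le_of_ne (not_lt.1 hlt) hne.symm)
    have hlt' : i.1 < j.1 := hlt
    have hj := j.2
    obtain ⟨m', h1, h2⟩ := ih (m - j.1 + i.1) (by omega)
    refine ⟨m', h1, ?_⟩
    rw [← h2, pow_add, show m = (m - j.1) + j.1 by omega, pow_add]
    rw [show s^j.1 = s^i.1 from hij.symm]
    simp

theorem perm_compress [Fintype M] {n : ℕ}
    (hperm : ∀ m m' : List M, m.Perm m' → (∀ x ∈ m, x ≠ 1) → 
      ∀ A B : List M, (∀ x ∈ A, x ≠ 1) → (∀ x ∈ B, x ≠ 1) → n ≤ A.length → n ≤ B.length →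
      A.prod * m.prod * B.prod = A.prod * m'.prod * B.prod)
    (Sig : Set M) (hSig : 1 ∉ Sig) (l : List M) (hl : ∀ x ∈ l, x ∈ Sig) :
    Cst (insert 1 Sig) ((Nat.log 2 (Fintype.card M) + 1) *
      (8 * Nat.log 2 (Fintype.card M) + 3 * n + 20)) l.prod := by
  classical
  set L := Nat.log 2 (Fintype.card M) with hL
  have small : ∀ l : List M, (∀ x ∈ l, x ∈ Sig) → Cst (insert 1 Sig) l.length l.prod := by
    intro l hl
    simpa using Cst.list_prod (r := 0) (A := insert 1 Sig) (by simp) l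
      (fun x hx => Cst.of_mem 0 (by simp [hl x hx]))
  by_cases hlen : l.length < 2 * n
  · exact (small l hl).le (by nlinarith)
  push Not at hlen
  set p := l.take n with hp
  set x := (l.drop n).take (l.length - 2 * n) with hx
  set q := (l.drop n).drop (l.length - 2 * n) with hq
  have hsplit : l = p ++ (x ++ q) := by
    rw [hx, hq, List.take_append_drop, hp, List.take_append_drop]
  have lp : p.length = n := by rw [hp, List.length_take]; omega
  have lq : q.length = n := by rw [hq, List.length_drop, List.length_drop]; omega
  have hpS : ∀ y ∈ p, y ∈ Sig := fun y hy => hl y (by rw [hsplit]; simp [hy])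
  have hxS : ∀ y ∈ x, y ∈ Sig := fun y hy => hl y (by rw [hsplit]; simp [hy])
  have hqS : ∀ y ∈ q, y ∈ Sig := fun y hy => hl y (by rw [hsplit]; simp [hy])
  have S1 : ∀ y ∈ Sig, y ≠ 1 := fun y hy h => hSig (h ▸ hy)
  have hperm' : ∀ m m' : List M, m.Perm m' → (∀ x ∈ m, x ∈ Sig) →
      p.prod * m.prod * q.prod = p.prod * m'.prod * q.prod := fun m m' h hm =>
    hperm m m' h (fun y hy => S1 y (hm y hy)) p q (fun y hy => S1 y (hpS y hy))
      (fun y hy => S1 y (hqS y hy)) lp.ge lq.ge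
  set idx := Fintype.equivFin M
  set wt : List M → ℕ := fun m => (m.map fun s => 2 ^ (idx s).1).sum with hwt
  obtain ⟨m, ⟨mS, mt⟩, mmin⟩ := exists_minimalFor_of_wellFoundedLT
    (fun m : List M => (∀ y ∈ m, y ∈ Sig) ∧ p.prod * m.prod * q.prod = l.prod) wt
    ⟨x, hxS, by rw [hsplit]; simp only [List.prod_append, mul_assoc]⟩
  set D := m.toFinset with hD
  have key : ∀ I ⊆ D, ∀ J ⊆ D, p.prod * I.toList.prod = p.prod * J.toList.prod →
      wt I.toList ≤ wt J.toList := by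
    intro I hI J hJ hIJ
    obtain ⟨r, hr⟩ : ∃ r, m.Perm (I.toList ++ r) := by
      have : I.toList.Subperm m := List.subperm_of_subset (Finset.nodup_toList I) (by
        intro y hy; simpa [hD] using hI (by simpa using hy))
      obtain ⟨l', hl1, hl2⟩ := this
      obtain ⟨r, hr⟩ := hl2.exists_perm_append
      exact ⟨r, hr.trans (hl1.append_right r)⟩
    have rS : ∀ y ∈ r, y ∈ Sig := fun y hy => mS y (hr.mem_iff.2 (by simp [hy]))
    have e1 := hperm' _ _ hr mS
    have e2 : p.prod * (J.toList ++ r).prod * q.prod = l.prod := by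
      rw [← mt, e1, List.prod_append, List.prod_append, ← mul_assoc, ← mul_assoc, hIJ]
    have w1 : wt m = wt I.toList + wt r := by
      simp only [hwt]
      rw [(hr.map _).sum_eq, List.map_append, List.sum_append]
    have w2 : wt (J.toList ++ r) = wt J.toList + wt r := by
      simp only [hwt]
      rw [List.map_append, List.sum_append]
    by_contra hcon
    have := mmin (j := J.toList ++ r) ⟨by
      intro y hy
      rcases List.mem_append.1 hy with hy | hy
      · exact mS y (by simpa [hD] using hJ (by simpa using hy))
      · exact rS y hy, e2⟩ (by omega)
    omega
  have wtF : ∀ I : Finset M, wt I.toList = ∑ i ∈ I.image (fun s => (idx s).1), 2^i := by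
    intro I
    rw [Finset.sum_image (fun a _ b _ h => idx.injective (Fin.ext h))]
    simp only [hwt]
    exact Finset.sum_map_toList I _
  have hcard : 2 ^ D.card ≤ Fintype.card M := by
    rw [← Finset.card_powerset, ← Finset.card_univ]
    refine Finset.card_le_card_of_injOn (fun I => p.prod * I.toList.prod)
      (fun _ _ => Finset.mem_univ _) ?_
    intro I hI J hJ h
    have hI' : I ⊆ D := by simpa using hI
    have hJ' : J ⊆ D := by simpa using hJ
    have e := le_antisymm (key I hI' J hJ' h) (key J hJ' I hI' h.symm)
    rw [wtF, wtF] at e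
    have := Finset.geomSum_injective (n := 2) le_rfl e
    exact Finset.image_injective (fun a b h => idx.injective (Fin.ext h)) this
  have hDL : D.card ≤ L := (Nat.le_log_iff_pow_le (by norm_num) (by
    have : 0 < Fintype.card M := Fintype.card_pos
    omega)).2 hcard
  obtain ⟨c, c1, c2, c3⟩ := perm_rep D.toList m (by intro y hy; simp [hD, hy])
  rw [← mt, hperm' _ _ c3 mS]
  have cc : Cst (insert 1 Sig) (L * (2 * L + 1)) (c.flatMap fun p => List.replicate p.2 p.1).prod := by
    have e : (c.flatMap fun p => List.replicate p.2 p.1).prod = (c.map fun p => p.1^p.2).prod := by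
      rw [List.flatMap, List.prod_flatten, List.map_map]
      congr 1
      apply List.map_congr_left
      intro a _
      simp
    rw [e]
    refine (Cst.list_prod (r := 2 * L) (by simp) _ ?_).le ?_
    · intro y hy
      obtain ⟨a, ha, rfl⟩ := List.mem_map.1 hy
      have haS : a.1 ∈ Sig := mS _ (by simpa [hD] using c2 a ha)
      obtain ⟨m', h1, h2⟩ := pow_red a.1 a.2
      rw [h2]
      refine (Cst.pow_aux (by simp [haS]) (by simp) m').le ?_
      have := Nat.log_mono_right (b := 2) h1
      omega
    · rw [List.length_map]
      rw [Finset.length_toList] at c1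
      exact Nat.mul_le_mul_right _ (by omega)
  refine (((small p hpS).mul cc).mul (small q hqS)).le ?_
  rw [lp, lq]
  nlinarith

end perm

section band

theorem band_lemma {M N α : Type*} [Monoid M] [Monoid N] (hN : ∀ a b : N, a * b * a = b * a)
    (c : α → N) (e f g : M) (ee : e * e = e) (ef : e * f = f) (fe : f * e = f)
    (eg : e * g = g) (ge : g * e = g) (ff : f * f = f) (gg : g * g = g) (fg : f * g = g)
    (gf : g * f = f) (hne : f ≠ g) : ∀ (t : ℕ) (u v : List α), u.length ≤ t →
    (∀ φ : α → M, (∀ q, φ q = e ∨ φ q = f ∨ φ q = g) →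
      e * (u.map φ).prod = e * (v.map φ).prod) → (u.map c).prod = (v.map c).prod := by
  classical
  -- constant maps
  have cst : ∀ a : M, e * a = a → a * a = a → ∀ u : List α, u ≠ [] →
      e * (u.map fun _ => a).prod = a := by
    intro a h1 h2 u
    induction u with
    | nil => simp
    | cons x u ih =>
      intro _
      rw [List.map_cons, List.prod_cons]
      by_cases hu : u = []
      · simp [hu, h1]
      · have := ih hu
        rw [← mul_assoc, h1]
        exact absorb_left _ a u (fun _ _ => rfl) h2
  have emp : ∀ u v : List α, (∀ φ : α → M, (∀ q, φ q = e ∨ φ q = f ∨ φ q = g) →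
      e * (u.map φ).prod = e * (v.map φ).prod) → u = [] → v = [] := by
    intro u v h hu
    by_contra hv
    subst hu
    have h1 := h (fun _ => f) (fun _ => Or.inr (Or.inl rfl))
    have h2 := h (fun _ => g) (fun _ => Or.inr (Or.inr rfl))
    rw [cst f ef ff v hv] at h1
    rw [cst g eg gg v hv] at h2
    apply hne
    rw [← h1, ← h2]
    simp
  have last : ∀ (φ : α → M), (∀ q, φ q = e ∨ φ q = f ∨ φ q = g) → ∀ a : M,
      e * a = a → f * a = a → g * a = a → ∀ u : List α, (u.map φ).prod * a = a := by
    intro φ hφ a h1 h2 h3 u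
    induction u with
    | nil => simp
    | cons x u ih =>
      rw [List.map_cons, List.prod_cons, mul_assoc, ih]
      rcases hφ x with h | h | h <;> rw [h] <;> assumption
  have filt : ∀ (φ : α → M), (∀ q, φ q = e ∨ φ q = f ∨ φ q = g) → ∀ x : α, ∀ u : List α,
      ∀ p : M, p * e = p → p * (u.map (Function.update φ x e)).prod =
        p * ((u.filter (fun y => ¬ y = x)).map φ).prod := by
    intro φ hφ x u
    induction u with
    | nil => intro p _; simp
    | cons y u ih =>
      intro p hp
      rw [List.map_cons, List.prod_cons, ← mul_assoc]
      by_cases hy : y = x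
      · subst hy
        rw [Function.update_self, hp, ih p hp]
        simp
      · rw [Function.update_of_ne hy, List.filter_cons_of_pos (by simpa using hy), List.map_cons,
          List.prod_cons, ← mul_assoc, ih]
        rcases hφ y with h | h | h <;> rw [h, mul_assoc]
        · rw [ee]
        · rw [fe]
        · rw [ge]
  have red : ∀ (x : α) (u : List α), (u.map c).prod * c x =
      ((u.filter (fun y => ¬ y = x)).map c).prod * c x := by
    intro x u
    induction u with
    | nil => simp
    | cons y u ih =>
      rw [List.map_cons, List.prod_cons]
      by_cases hy : y = x
      · subst hy
        rw [hN, ih]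
        simp
      · rw [List.filter_cons_of_pos (by simpa using hy), List.map_cons,
          List.prod_cons, mul_assoc, ih, mul_assoc]
  intro t
  induction t with
  | zero =>
    intro u v hu h
    have hu' : u = [] := by simpa using hu
    rw [emp u v h hu', hu']
  | succ t ih =>
    intro u v hu h
    rcases List.eq_nil_or_concat u with hu0 | ⟨u0, x, hux⟩
    · rw [emp u v h hu0, hu0]
    rcases List.eq_nil_or_concat v with hv0 | ⟨v0, y, hvy⟩
    · rw [hv0, emp v u (fun φ hφ => (h φ hφ).symm) hv0]
    have hxy : x = y := by
      by_contra hxy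
      have hφ : ∀ q, (fun q => if q = x then f else g) q = e ∨
          (fun q => if q = x then f else g) q = f ∨
          (fun q => if q = x then f else g) q = g := by
        intro q
        by_cases hq : q = x <;> simp [hq]
      have := h (fun q => if q = x then f else g) hφ
      rw [hux, hvy, List.concat_eq_append, List.concat_eq_append, List.map_append, List.map_append,
        List.prod_append, List.prod_append] at this
      simp only [List.map_cons, List.map_nil, List.prod_cons, List.prod_nil, mul_one, if_true,
        if_neg (Ne.symm hxy)] at this
      rw [last _ hφ f ef ff gf, last _ hφ g eg fg gg, ef, eg] at this
      exact hne this
    subst hxy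
    have key := ih (u.filter (fun y => ¬ y = x)) (v.filter (fun y => ¬ y = x)) (by
      have : (u.filter (fun y => ¬ y = x)).length < u.length := by
        apply List.length_filter_lt_length_iff_exists.2
        exact ⟨x, by simp [hux], by simp⟩
      omega) (by
      intro φ hφ
      rw [← filt φ hφ x u e ee, ← filt φ hφ x v e ee]
      apply h
      intro q
      by_cases hq : q = x
      · subst hq; simp
      · rw [Function.update_of_ne hq]; exact hφ q)
    have fin : ∀ (w w0 : List α), w = w0 ++ [x] → (w.map c).prod =
        ((w.filter (fun y => ¬ y = x)).map c).prod * c x := by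
      intro w w0 hw
      rw [hw, List.map_append, List.prod_append]
      simp only [List.map_cons, List.map_nil, List.prod_cons, List.prod_nil, mul_one]
      rw [red]
      simp [List.filter_append]
    rw [fin u u0 (by simpa using hux), fin v v0 (by simpa using hvy), key]

theorem band_lemma' {M N α : Type*} [Monoid M] [Monoid N] (hN : ∀ a b : N, a * b * a = a * b)
    (c : α → N) (e f g : M) (ee : e * e = e) (ef : e * f = f) (fe : f * e = f)
    (eg : e * g = g) (ge : g * e = g) (ff : f * f = f) (gg : g * g = g) (fg : f * g = f)
    (gf : g * f = g) (hne : f ≠ g) (u v : List α)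
    (h : ∀ φ : α → M, (∀ q, φ q = e ∨ φ q = f ∨ φ q = g) →
      (u.map φ).prod * e = (v.map φ).prod * e) : (u.map c).prod = (v.map c).prod := by
  have opl : ∀ {K : Type _} [Monoid K] (φ : α → K) (w : List α),
      (w.reverse.map (fun q => MulOpposite.op (φ q))).prod = MulOpposite.op (w.map φ).prod := by
    intro K _ φ w
    rw [MulOpposite.op_list_prod, List.map_map, List.map_reverse]
    rfl
  have opl' : ∀ {K : Type _} [Monoid K] (φ : α → K) (w : List α),
      (w.reverse.map (fun q => MulOpposite.op (φ q))).prod = MulOpposite.op (w.map φ).prod := by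
    intro K _ φ w
    rw [MulOpposite.op_list_prod, List.map_map, List.map_reverse]
    rfl
  have := band_lemma (M := Mᵐᵒᵖ) (N := Nᵐᵒᵖ) (fun a b => by
      apply MulOpposite.unop_injective
      simp only [MulOpposite.unop_mul, ← mul_assoc]
      exact hN _ _) (fun q => MulOpposite.op (c q)) (MulOpposite.op e) (MulOpposite.op f)
      (MulOpposite.op g) (by rw [← MulOpposite.op_mul, ee]) (by rw [← MulOpposite.op_mul, fe])
      (by rw [← MulOpposite.op_mul, ef]) (by rw [← MulOpposite.op_mul, ge])
      (by rw [← MulOpposite.op_mul, eg]) (by rw [← MulOpposite.op_mul, ff])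
      (by rw [← MulOpposite.op_mul, gg]) (by rw [← MulOpposite.op_mul, gf])
      (by rw [← MulOpposite.op_mul, fg]) (fun hh => hne (MulOpposite.op_injective hh))
      u.reverse.length u.reverse v.reverse le_rfl (by
        intro φ hφ
        have := h (fun q => (φ q).unop) (by
          intro q
          rcases hφ q with h | h | h <;> simp [h])
        have e1 := opl (fun q => (φ q).unop) u
        have e2 := opl (fun q => (φ q).unop) v
        simp only [MulOpposite.op_unop] at e1 e2
        rw [e1, e2, ← MulOpposite.op_mul, this, MulOpposite.op_mul])
  rw [opl', opl'] at this
  exact MulOpposite.op_injective this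

end band

section birkhoff

theorem pow_mem (V : Pseudovariety) (S : Type) [Semigroup S] [Fintype S] (hS : V.mem S) (n : ℕ) :
    V.mem (Fin (n+1) → S) := by
  induction n with
  | zero =>
    refine V.closed_sub _ S ⟨fun x => x 0, fun _ _ => rfl⟩ ?_ hS
    intro x y h
    funext i
    rw [Fin.fin_one_eq_zero i]; exact h
  | succ n ih =>
    refine V.closed_sub _ (S × (Fin (n+1) → S)) ⟨fun x => (x 0, fun i => x i.succ), fun _ _ => rfl⟩ ?_
      (V.closed_prod _ _ hS ih)
    intro x y h
    have h1 : x 0 = y 0 := congrArg Prod.fst h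
    have h2 : (fun i : Fin (n+1) => x i.succ) = fun i => y i.succ := congrArg Prod.snd h
    funext i
    refine Fin.cases h1 (fun i => congrFun h2 i) i

theorem birk (V : Pseudovariety) (S : Type) [Semigroup S] [Fintype S] [Nonempty S] (hS : V.mem S)
    (Q : Type) [Semigroup Q] [Fintype Q] (hQ : ¬ V.mem Q) :
    ∃ u v : FreeSemigroup Q, (∀ φ : Q → S, FreeSemigroup.lift φ u = FreeSemigroup.lift φ v) ∧
      FreeSemigroup.lift (id : Q → Q) u ≠ FreeSemigroup.lift (id : Q → Q) v := by
  classical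
  by_contra hcon
  push Not at hcon
  apply hQ
  let π : FreeSemigroup Q →ₙ* ((Q → S) → S) := FreeSemigroup.lift (fun q φ => φ q)
  have hπ : ∀ u φ, π u φ = FreeSemigroup.lift φ u := by
    intro u φ
    have : (Pi.evalMulHom (fun _ : Q → S => S) φ).comp π = FreeSemigroup.lift φ := by
      apply FreeSemigroup.hom_ext
      funext q
      simp [π]
    exact DFunLike.congr_fun this u
  let F := π.srange
  let _ : Fintype F := Fintype.ofFinite F
  have memP : V.mem ((Q → S) → S) := by
    obtain ⟨n, hn⟩ : ∃ n, Fintype.card (Q → S) = n + 1 :=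
      ⟨Fintype.card (Q → S) - 1, by
        have : 0 < Fintype.card (Q → S) := Fintype.card_pos
        omega⟩
    let eqv := Fintype.equivFinOfCardEq hn
    refine V.closed_sub _ (Fin (n+1) → S) ⟨fun x i => x (eqv.symm i), fun _ _ => rfl⟩ ?_ (pow_mem V S hS n)
    intro x y h
    funext i
    have := congrFun h (eqv i)
    simpa using this
  have memF : V.mem F := V.closed_sub F _ (MulMemClass.subtype F) Subtype.val_injective memP
  have hch : ∀ x : F, ∃ u, π u = x.1 := fun x => x.2
  choose ch hch using hch
  have hg : ∀ (u : FreeSemigroup Q) (x : F), π u = x.1 →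
      FreeSemigroup.lift (id : Q → Q) (ch x) = FreeSemigroup.lift (id : Q → Q) u := by
    intro u x hu
    apply hcon
    intro φ
    rw [← hπ, ← hπ, hch, hu]
  refine V.closed_hom F Q ⟨fun x => FreeSemigroup.lift (id : Q → Q) (ch x), ?_⟩ ?_ memF
  · intro x y
    rw [← map_mul]
    apply hg
    rw [map_mul, hch, hch]
    rfl
  · intro q
    refine ⟨⟨π (FreeSemigroup.of q), ⟨_, rfl⟩⟩, ?_⟩
    have := hg (FreeSemigroup.of q) ⟨π (FreeSemigroup.of q), ⟨_, rfl⟩⟩ rfl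
    simpa using this

theorem lift_list {Q S : Type} [Semigroup S] (u : FreeSemigroup Q) (φ : Q → S) :
    ((u.head :: u.tail).map (fun q => (φ q : WithOne S))).prod = (FreeSemigroup.lift φ u : WithOne S) := by
  induction u using FreeSemigroup.recOnMul with
  | ih1 x =>
    rw [FreeSemigroup.lift_of]
    simp [FreeSemigroup.of]
  | ih2 x y h1 h2 =>
    rw [map_mul, WithOne.coe_mul, ← h2, ← h1, ← List.prod_append, ← List.map_append]
    rfl

theorem birk' (V : Pseudovariety) (S : Type) [Semigroup S] [Fintype S] [Nonempty S] (hS : V.mem S)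
    (Q : Type) [Semigroup Q] [Fintype Q] (hQ : ¬ V.mem Q) :
    ∃ u v : List Q, u ≠ [] ∧ v ≠ [] ∧ (∀ φ : Q → WithOne S, (∀ q, φ q ≠ 1) →
      (u.map φ).prod = (v.map φ).prod) ∧
      (u.map (fun q : Q => (q : WithOne Q))).prod ≠ (v.map (fun q : Q => (q : WithOne Q))).prod := by
  obtain ⟨u, v, h1, h2⟩ := birk V S hS Q hQ
  refine ⟨u.head :: u.tail, v.head :: v.tail, by simp, by simp, ?_, ?_⟩
  · intro φ hφ
    have : ∀ q, ∃ s : S, (s : WithOne S) = φ q := fun q => WithOne.ne_one_iff_exists.1 (hφ q)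
    choose ψ hψ using this
    have e : φ = fun q => (ψ q : WithOne S) := funext fun q => (hψ q).symm
    rw [e, lift_list, lift_list, h1]
  · intro h
    have a := lift_list u (id : Q → Q)
    have b := lift_list v (id : Q → Q)
    simp only [id] at a b
    rw [a, b] at h
    exact h2 (WithOne.coe_inj.1 h)

theorem wo_cases {S : Type*} (x : WithOne S) : x = 1 ∨ ∃ a : S, x = (a : WithOne S) := by
  rcases eq_or_ne x 1 with h | h
  · exact Or.inl h
  · obtain ⟨a, ha⟩ := WithOne.ne_one_iff_exists.1 h
    exact Or.inr ⟨a, ha.symm⟩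

theorem nu_withOne {S : Type*} [Semigroup S] (x y : WithOne S) (h : x * y = 1) : x = 1 ∧ y = 1 := by
  rcases wo_cases x with rfl | ⟨a, rfl⟩
  · exact ⟨rfl, by simpa using h⟩
  · rcases wo_cases y with rfl | ⟨b, rfl⟩
    · simp at h
    · rw [← WithOne.coe_mul] at h
      exact absurd h WithOne.coe_ne_one

theorem rr_of (V : Pseudovariety) (S : Type) [Semigroup S] [Fintype S] [Nonempty S] (hS : V.mem S)
    (Q : Type) [Semigroup Q] [Fintype Q] (hQ : ¬ V.mem Q) (hR : IsRRB Q) (e f g : WithOne S)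
    (e1 : e ≠ 1) (ee : e * e = e) (ef : e * f = f) (fe : f * e = f)
    (eg : e * g = g) (ge : g * e = g) (ff : f * f = f) (gg : g * g = g) (fg : f * g = g)
    (gf : g * f = f) : f = g := by
  by_contra hne
  obtain ⟨u, v, -, -, h1, h2⟩ := birk' V S hS Q hQ
  apply h2
  refine band_lemma (M := WithOne S) (N := WithOne Q) ?_ _ e f g ee ef fe eg ge ff gg fg gf hne
    u.length u v le_rfl ?_
  · intro a b
    rcases wo_cases a with rfl | ⟨a, rfl⟩
    · simp
    · rcases wo_cases b with rfl | ⟨b, rfl⟩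
      · rw [mul_one, one_mul, ← WithOne.coe_mul, hR.1]
      · rw [← WithOne.coe_mul, ← WithOne.coe_mul, ← WithOne.coe_mul, hR.2]
  · intro φ hφ
    rw [h1 φ]
    intro q
    rcases hφ q with h | h | h <;> rw [h]
    · exact e1
    · intro h; rw [h, mul_one] at ef; exact e1 ef
    · intro h; rw [h, mul_one] at eg; exact e1 eg

theorem ll_of (V : Pseudovariety) (S : Type) [Semigroup S] [Fintype S] [Nonempty S] (hS : V.mem S)
    (Q : Type) [Semigroup Q] [Fintype Q] (hQ : ¬ V.mem Q) (hR : IsLRB Q) (e f g : WithOne S)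
    (e1 : e ≠ 1) (ee : e * e = e) (ef : e * f = f) (fe : f * e = f)
    (eg : e * g = g) (ge : g * e = g) (ff : f * f = f) (gg : g * g = g) (fg : f * g = f)
    (gf : g * f = g) : f = g := by
  by_contra hne
  obtain ⟨u, v, -, -, h1, h2⟩ := birk' V S hS Q hQ
  apply h2
  refine band_lemma' (M := WithOne S) (N := WithOne Q) ?_ _ e f g ee ef fe eg ge ff gg fg gf hne
    u v ?_
  · intro a b
    rcases wo_cases a with rfl | ⟨a, rfl⟩
    · simp
    · rcases wo_cases b with rfl | ⟨b, rfl⟩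
      · rw [mul_one, ← WithOne.coe_mul, hR.1]
      · rw [← WithOne.coe_mul, ← WithOne.coe_mul, hR.2]
  · intro φ hφ
    rw [h1 φ]
    intro q
    rcases hφ q with h | h | h <;> rw [h]
    · exact e1
    · intro h; rw [h, mul_one] at ef; exact e1 ef
    · intro h; rw [h, mul_one] at eg; exact e1 eg

end birkhoff

section tnil

theorem prod_zero {Q : Type} [Semigroup Q] (z : Q) (hz : ∀ s : Q, z * s = z ∧ s * z = z)
    (h1 : ∀ x : Q, x * x = z) (h2 : ∀ x y : Q, x * y * x = z) (u : List Q) (hu : ¬ u.Nodup) :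
    (u.map (fun q : Q => (q : WithOne Q))).prod = (z : WithOne Q) := by
  classical
  rw [List.nodup_iff_count_le_one] at hu
  push Not at hu
  obtain ⟨x, hx⟩ := hu
  have hm : x ∈ u := List.count_pos_iff.1 (by omega)
  obtain ⟨a, u1, rfl, ha⟩ := List.eq_append_cons_of_mem hm
  have hm2 : x ∈ u1 := by
    apply List.count_pos_iff.1
    rw [List.count_append, List.count_eq_zero_of_not_mem ha, List.count_cons_self] at hx
    omega
  obtain ⟨b, c, rfl, -⟩ := List.eq_append_cons_of_mem hm2
  simp only [List.map_append, List.map_cons, List.prod_append, List.prod_cons]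
  generalize (a.map (fun q : Q => (q : WithOne Q))).prod = A
  generalize (b.map (fun q : Q => (q : WithOne Q))).prod = B
  generalize (c.map (fun q : Q => (q : WithOne Q))).prod = C
  have e1 : (x : WithOne Q) * B * x = z := by
    rcases wo_cases B with rfl | ⟨b, rfl⟩
    · rw [mul_one, ← WithOne.coe_mul, h1]
    · rw [← WithOne.coe_mul, ← WithOne.coe_mul, h2]
  have e2 : (z : WithOne Q) * C = z := by
    rcases wo_cases C with rfl | ⟨b, rfl⟩
    · rw [mul_one]
    · rw [← WithOne.coe_mul, (hz _).1]
  have e3 : A * (z : WithOne Q) = z := by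
    rcases wo_cases A with rfl | ⟨b, rfl⟩
    · rw [one_mul]
    · rw [← WithOne.coe_mul, (hz _).2]
  rw [← mul_assoc B, ← mul_assoc (x : WithOne Q), ← mul_assoc (x : WithOne Q), e1, e2, e3]

theorem idt_of_words {Q M : Type} [DecidableEq Q] [Monoid M] (nu : ∀ x y : M, x * y = 1 → x = 1 ∧ y = 1)
    (u v : List Q) (hu0 : u ≠ []) (hu : u.Nodup)
    (h : ∀ φ : Q → M, (∀ q, φ q ≠ 1) → (u.map φ).prod = (v.map φ).prod) (huv : u ≠ v) :
    ∃ w : List (Fin u.length), (∀ i, i ∈ w) ∧ w ≠ List.finRange u.length ∧ Idt M u.length w := by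
  have hpos : 0 < u.length := List.length_pos_iff.2 hu0
  let g : Q → Fin u.length := fun q =>
    if h : q ∈ u then ⟨u.idxOf q, List.idxOf_lt_length_iff.2 h⟩ else ⟨0, hpos⟩
  have hgu : ∀ i : Fin u.length, g (u.get i) = i := by
    intro i
    have : u.get i ∈ u := List.get_mem u i
    simp only [g, dif_pos this]
    apply Fin.ext
    simp [hu.idxOf_getElem]
  have hug : ∀ q ∈ u, u.get (g q) = q := by
    intro q hq
    simp [g, dif_pos hq]
  have hmap : u.map g = List.finRange u.length := by
    refine (congrArg (List.map g) (List.map_get_finRange u)).symm.trans ?_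
    rw [List.map_map]
    conv_rhs => rw [← List.map_id (List.finRange u.length)]
    apply List.map_congr_left
    intro i _
    exact hgu i
  by_cases hall : ∀ q ∈ u, q ∈ v
  · refine ⟨v.map g, ?_, ?_, ?_⟩
    · intro i
      exact List.mem_map.2 ⟨u.get i, hall _ (List.get_mem u i), hgu i⟩
    · intro heq
      apply huv
      have hlen : v.length = u.length := by
        have := congrArg List.length heq
        simpa using this
      have hsub : u.Subperm v := List.subperm_of_subset hu hall
      have hp : u.Perm v := hsub.perm_of_length_le hlen.le
      have e1 : ∀ w : List Q, (∀ q ∈ w, q ∈ u) → (w.map g).map u.get = w := by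
        intro w hw
        rw [List.map_map]
        conv_rhs => rw [← List.map_id w]
        apply List.map_congr_left
        intro q hq
        exact hug q (hw q hq)
      rw [← e1 u (fun _ hq => hq), ← e1 v (fun q hq => hp.mem_iff.2 hq), heq, hmap]
    · intro x hx
      have := h (fun q => x (g q)) (fun q => hx _)
      rw [← hmap, List.map_map, List.map_map]
      exact this
  · push Not at hall
    obtain ⟨q0, hq0, hq0v⟩ := hall
    let i := g q0
    let R := List.finRange u.length
    have hRn : R.Nodup := List.nodup_finRange _
    obtain ⟨s1, s2, s3⟩ := split_at R hRn i (List.mem_finRange i)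
    generalize R.take (R.idxOf i) = a at s1 s2
    generalize R.drop (R.idxOf i + 1) = b at s1 s3
    refine ⟨a ++ i :: i :: b, ?_, ?_, ?_⟩
    · intro j
      have : j ∈ R := List.mem_finRange j
      rw [s1] at this
      simp only [List.mem_append, List.mem_cons] at this ⊢
      tauto
    · intro heq
      have e2 : a ++ i :: i :: b = a ++ i :: b := heq.trans s1
      have := congrArg List.length e2
      simp at this
    · intro x hx
      let y := Function.update x i (x i * x i)
      have hy : ∀ j, y j ≠ 1 := by
        intro j
        by_cases hj : j = i
        · subst hj
          simp only [y, Function.update_self]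
          intro hc
          exact hx _ (nu _ _ hc).1
        · simp only [y, Function.update_of_ne hj]
          exact hx j
      have p1 := h (fun q => if q ∈ u then x (g q) else x i) (by
        intro q; split_ifs <;> apply hx)
      have p2 := h (fun q => if q ∈ u then y (g q) else x i) (by
        intro q; split_ifs
        · apply hy
        · apply hx)
      have e3 : v.map (fun q => if q ∈ u then x (g q) else x i) =
          v.map (fun q => if q ∈ u then y (g q) else x i) := by
        apply List.map_congr_left
        intro q hq
        by_cases hqu : q ∈ u
        · have : g q ≠ i := by
            intro hc
            apply hq0v
            rw [← hug q0 hq0, show g q0 = g q from hc.symm, hug q hqu]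
            exact hq
          simp only [if_pos hqu, y, Function.update_of_ne this]
        · simp only [if_neg hqu]
      rw [e3, ← p2] at p1
      have e4 : ∀ x' : Fin u.length → M, u.map (fun q => if q ∈ u then x' (g q) else x i) = R.map x' := by
        intro x'
        show _ = (List.finRange u.length).map x'
        rw [← hmap, List.map_map]
        apply List.map_congr_left
        intro q hq
        simp [hq]
      rw [e4, e4] at p1
      show (R.map x).prod = _
      rw [p1, s1, List.map_append, List.map_cons, map_update_of_notMem _ _ s2,
        map_update_of_notMem _ _ s3]
      simp [y, mul_assoc]

theorem idt_of_tnil (V : Pseudovariety) (S : Type) [Semigroup S] [Fintype S] [Nonempty S]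
    (hS : V.mem S) (Q : Type) [Semigroup Q] [Fintype Q] (hQ : ¬ V.mem Q) (hT : IsTNil Q) :
    ∃ l, l ≤ Fintype.card Q ∧ ∃ w : List (Fin l), (∀ i, i ∈ w) ∧ w ≠ List.finRange l ∧
      Idt (WithOne S) l w := by
  classical
  obtain ⟨z, hz, hz1, hz2⟩ := hT
  obtain ⟨u, v, hu, hv, h1, h2⟩ := birk' V S hS Q hQ
  have huv : u ≠ v := by rintro rfl; exact h2 rfl
  by_cases hun : u.Nodup
  · exact ⟨u.length, hun.length_le_card, idt_of_words nu_withOne u v hu hun h1 huv⟩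
  by_cases hvn : v.Nodup
  · exact ⟨v.length, hvn.length_le_card, idt_of_words nu_withOne v u hv hvn
      (fun φ hφ => (h1 φ hφ).symm) huv.symm⟩
  exact absurd ((prod_zero z hz hz1 hz2 u hun).trans (prod_zero z hz hz1 hz2 v hvn).symm) h2

theorem compress_V (V : Pseudovariety) (S : Type) [Semigroup S] [Fintype S] [Fintype (WithOne S)] [Nonempty S]
    (hS : V.mem S) (QL : Type) [Semigroup QL] [Fintype QL] (hL : IsLRB QL) (hL' : ¬ V.mem QL)
    (QR : Type) [Semigroup QR] [Fintype QR] (hR : IsRRB QR) (hR' : ¬ V.mem QR)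
    (QT : Type) [Semigroup QT] [Fintype QT] (hT : IsTNil QT) (hT' : ¬ V.mem QT)
    (Sig : Set (WithOne S)) (hSig : 1 ∉ Sig) (l : List (WithOne S)) (hl : ∀ x ∈ l, x ∈ Sig) :
    Cst (insert 1 Sig) ((Nat.log 2 (Fintype.card (WithOne S)) + 1) *
      (8 * Nat.log 2 (Fintype.card (WithOne S)) + 3 * Fintype.card QT + 20)) l.prod := by
  obtain ⟨m, hm, w, w1, w2, hid⟩ := idt_of_tnil V S hS QT hT' hT
  by_cases hw : w.Nodup
  · exact perm_compress (perm_of_idt nu_withOne hm w w1 hw w2 hid) Sig hSig l hl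
  · obtain ⟨k, k3, hk⟩ := ha_of_idt nu_withOne w hw hid
    exact Good.compress (k := k) ⟨k3, nu_withOne, hk, rr_of V S hS QR hR' hR, ll_of V S hS QL hL' hL⟩
      (longL_of_idt hm w w1 hw hid) Sig hSig l hl

end tnil

section convert

theorem sl_nil {S : Type*} [Semigroup S] (Sig : Set S) : IsSLSeq Sig [] := fun m => m.elim0

theorem sl_snoc {S : Type*} [Semigroup S] {Sig : Set S} {L : List S} (hL : IsSLSeq Sig L) (c : S)
    (hc : c ∈ Sig ∨ ∃ a ∈ L, ∃ b ∈ L, c = a * b) : IsSLSeq Sig (L ++ [c]) := by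
  rintro ⟨m, hm⟩
  have hm' : m < L.length + 1 := by simpa using hm
  have hlen : (L ++ [c]).length = L.length + 1 := by simp
  simp only [List.get_eq_getElem]
  rcases Nat.lt_or_ge m L.length with h | h
  · rw [List.getElem_append_left h]
    rcases hL ⟨m, h⟩ with h1 | ⟨i, j, hi, hj, e⟩
    · exact Or.inl h1
    · refine Or.inr ⟨⟨i, by omega⟩, ⟨j, by omega⟩, hi, hj, ?_⟩
      rw [List.getElem_append_left i.2, List.getElem_append_left j.2]
      exact e
  · have : m = L.length := by omega
    subst this
    rw [List.getElem_concat_length rfl]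
    rcases hc with h1 | ⟨a, ha, b, hb, e⟩
    · exact Or.inl h1
    · obtain ⟨i, hi, rfl⟩ := List.mem_iff_getElem.1 ha
      obtain ⟨j, hj, rfl⟩ := List.mem_iff_getElem.1 hb
      refine Or.inr ⟨⟨i, by omega⟩, ⟨j, by omega⟩, hi, hj, ?_⟩
      simp only [List.getElem_append_left hi, List.getElem_append_left hj]
      exact e

theorem pr_sl {S : Type*} [Semigroup S] (Sig : Set S) {r : ℕ} {B : Set (WithOne S)}
    (h : Pr (insert 1 ((fun s : S => (s : WithOne S)) '' Sig)) r B) :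
    ∃ L : List S, IsSLSeq Sig L ∧ L.length ≤ 3 * r ∧
      ∀ x ∈ B, x = 1 ∨ ∃ s : S, x = (s : WithOne S) ∧ (s ∈ Sig ∨ s ∈ L) := by
  induction h with
  | base =>
    refine ⟨[], sl_nil _, by simp, ?_⟩
    rintro x (rfl | ⟨s, hs, rfl⟩)
    · exact Or.inl rfl
    · exact Or.inr ⟨s, rfl, Or.inl hs⟩
  | @step r B x y h hx hy ih =>
    obtain ⟨L, hL, hlen, hB⟩ := ih
    have keep : ∀ x ∈ B, x = 1 ∨ ∃ s : S, x = (s : WithOne S) ∧ (s ∈ Sig ∨ s ∈ L) := hB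
    rcases hB x hx with rfl | ⟨a, rfl, ha⟩
    · refine ⟨L, hL, by omega, ?_⟩
      rintro x (rfl | h)
      · rw [one_mul]; exact hB y hy
      · exact hB x h
    rcases hB y hy with rfl | ⟨b, rfl, hb⟩
    · refine ⟨L, hL, by omega, ?_⟩
      rintro x (rfl | h)
      · rw [mul_one]; exact hB _ hx
      · exact hB x h
    have add : ∀ L : List S, IsSLSeq Sig L → ∀ a, a ∈ Sig ∨ a ∈ L → ∃ L' : List S, IsSLSeq Sig L' ∧
        L'.length ≤ L.length + 1 ∧ a ∈ L' ∧ ∀ s ∈ L, s ∈ L' := by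
      intro L hL a ha
      rcases ha with ha | ha
      · exact ⟨L ++ [a], sl_snoc hL a (Or.inl ha), by simp, by simp, fun s hs => by simp [hs]⟩
      · exact ⟨L, hL, by omega, ha, fun s hs => hs⟩
    obtain ⟨L1, hL1, hl1, ha1, k1⟩ := add L hL a ha
    obtain ⟨L2, hL2, hl2, hb2, k2⟩ := add L1 hL1 b (hb.imp id (k1 b))
    refine ⟨L2 ++ [a * b], sl_snoc hL2 _ (Or.inr ⟨a, k2 a ha1, b, hb2, rfl⟩), ?_, ?_⟩
    · simp only [List.length_append, List.length_singleton]; omega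
    · rintro x (rfl | h)
      · exact Or.inr ⟨a * b, by rw [WithOne.coe_mul], Or.inr (by simp)⟩
      · rcases hB x h with h | ⟨s, e, hs⟩
        · exact Or.inl h
        · exact Or.inr ⟨s, e, hs.imp id fun hs => by simp [k2 s (k1 s hs)]⟩

theorem slCost_le {S : Type*} [Semigroup S] (Sig : Set S) (t : S) (r : ℕ)
    (h : Cst (insert 1 ((fun s : S => (s : WithOne S)) '' Sig)) r (t : WithOne S)) :
    slCost Sig t ≤ 3 * r + 1 := by
  obtain ⟨r', hr, B, hB, ht⟩ := h
  obtain ⟨L, hL, hlen, hall⟩ := pr_sl Sig hB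
  rcases hall _ ht with h | ⟨s, e, hs⟩
  · exact absurd h WithOne.coe_ne_one
  have e' : t = s := WithOne.coe_inj.1 e
  subst e'
  rcases hs with hs | hs
  · have : slCost Sig t ≤ 1 := Nat.sInf_le ⟨[t], by simpa using sl_snoc (sl_nil Sig) t (Or.inl hs), by simp, rfl⟩
    omega
  · have : slCost Sig t ≤ L.length := Nat.sInf_le ⟨L, hL, hs, rfl⟩
    omega

theorem closure_list {S : Type*} [Semigroup S] (Sig : Set S) (t : S) (ht : t ∈ Subsemigroup.closure Sig) :
    ∃ l : List (WithOne S), (∀ x ∈ l, x ∈ (fun s : S => (s : WithOne S)) '' Sig) ∧ l.prod = t := by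
  induction ht using Subsemigroup.closure_induction with
  | mem x hx => exact ⟨[(x : WithOne S)], by simpa using hx, by simp⟩
  | mul x y hx hy h1 h2 =>
    obtain ⟨l1, a1, b1⟩ := h1
    obtain ⟨l2, a2, b2⟩ := h2
    refine ⟨l1 ++ l2, ?_, by rw [List.prod_append, b1, b2, WithOne.coe_mul]⟩
    intro x hx
    rcases List.mem_append.1 hx with h | h
    · exact a1 x h
    · exact a2 x h

theorem numerics (N n : ℕ) (hN : 0 < N) (s : ℕ) (hs : s ≤ 3 * ((Nat.log 2 (N + 1) + 1) *
      (8 * Nat.log 2 (N + 1) + 3 * n + 20)) + 1) :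
    (s : ℝ) ≤ (18 * n + 169) * (Real.logb 2 N + 1) ^ 2 := by
  have h1 : Nat.log 2 (N + 1) ≤ Nat.log 2 N + 1 := by
    rw [← Nat.log_mul_base (by norm_num) (by omega)]
    exact Nat.log_mono_right (by omega)
  have h2 : ((Nat.log 2 N : ℕ) : ℝ) ≤ Real.logb 2 N := by
    exact_mod_cast Real.natLog_le_logb N 2
  have h0 : (0 : ℝ) ≤ Nat.log 2 N := Nat.cast_nonneg _
  have h3 : (Nat.log 2 (N + 1) : ℝ) ≤ Nat.log 2 N + 1 := by exact_mod_cast h1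
  set x := Real.logb 2 N
  have hx : 0 ≤ x := h0.trans h2
  have hn : (0 : ℝ) ≤ n := Nat.cast_nonneg _
  have h5 : (s : ℝ) ≤ 3 * (((Nat.log 2 (N + 1) : ℕ) + 1 : ℝ) *
      (8 * (Nat.log 2 (N + 1) : ℕ) + 3 * n + 20)) + 1 := by exact_mod_cast hs
  have hy : (Nat.log 2 (N + 1) : ℝ) ≤ x + 1 := by linarith
  have hy0 : (0 : ℝ) ≤ Nat.log 2 (N + 1) := Nat.cast_nonneg _
  generalize (Nat.log 2 (N + 1) : ℝ) = y at *
  have h6 : (y + 1) * (8 * y + 3 * n + 20) ≤ (x + 2) * (8 * x + 3 * n + 28) := by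
    apply mul_le_mul <;> nlinarith
  nlinarith [mul_nonneg hx hn, mul_nonneg hx hx, mul_nonneg (mul_nonneg hx hx) hn]

end convert

end SLC

/-- a pseudovariety excluding a left-regular band, a right-regular band,
and a `T`-semigroup admits straight-line programs of length `O(log² N)`. -/
theorem pseudovariety_excluding_obstructions_quadratic_log_compression
    (V : Pseudovariety)
    (hLRB : ∃ (S : Type) (iS : Semigroup S) (fS : Fintype S),
      @IsLRB S iS ∧ ¬ @Pseudovariety.mem V S iS fS)
    (hRRB : ∃ (S : Type) (iS : Semigroup S) (fS : Fintype S),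
      @IsRRB S iS ∧ ¬ @Pseudovariety.mem V S iS fS)
    (hT : ∃ (S : Type) (iS : Semigroup S) (fS : Fintype S),
      @IsTNil S iS ∧ ¬ @Pseudovariety.mem V S iS fS) :
    ∃ c : ℝ, 0 < c ∧
      ∀ (S : Type) [Semigroup S] [Fintype S], V.mem S →
        ∀ (Sig : Set S) (t : S), t ∈ Subsemigroup.closure Sig →
          (slCost Sig t : ℝ) ≤ c * (Real.logb 2 (Fintype.card S) + 1) ^ 2 := by
  obtain ⟨QL, iL, fL, hL, hL'⟩ := hLRB
  obtain ⟨QR, iR, fR, hR, hR'⟩ := hRRB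
  obtain ⟨QT, iT, fT, hQT, hQT'⟩ := hT
  refine ⟨18 * Fintype.card QT + 169, by positivity, ?_⟩
  intro S _ _ hS Sig t ht
  have : Nonempty S := ⟨t⟩
  let fW : Fintype (WithOne S) := inferInstanceAs (Fintype (Option S))
  have hcard : Fintype.card (WithOne S) = Fintype.card S + 1 := Fintype.card_option
  obtain ⟨l, hl, hlt⟩ := SLC.closure_list Sig t ht
  have h1 : (1 : WithOne S) ∉ (fun s : S => (s : WithOne S)) '' Sig := by
    rintro ⟨s, -, hs⟩
    exact WithOne.coe_ne_one hs
  have := SLC.compress_V V S hS QL hL hL' QR hR hR' QT hQT hQT' _ h1 l hl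
  rw [hlt, hcard] at this
  exact SLC.numerics _ _ Fintype.card_pos _ (SLC.slCost_le Sig t _ this)
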